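/- For any skew shape μ/λ, the map jdt_GG : BFT(μ/λ) → EXQ(μ/λ) is a bijection, and it is weight-preserving: if jdt_GG(Q) = E, then wt(Q) = wt(E). -/

import Mathlib

/-!
Common definitions: mixed tableaux, tableau switching, shuffling, GG-jdt,
hook-valued tableaux and the uncrowding algorithms.
Conventions: French notation, cells `(i, j)` with `i` the row index (counted
from the bottom) and `j` the column index, both `≥ 1`.
-/

open scoped Classical

abbrev Cell : Type := ℕ × ℕ

/-- The cell directly above `c`. -/
def upCell (c : Cell) : Cell := (c.1 + 1, c.2)

/-- The cell directly to the right of `c`. -/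
def rtCell (c : Cell) : Cell := (c.1, c.2 + 1)

/-- A (finite) partition shape: a finite lower-order ideal of cells in the
positive quadrant (1-indexed, French notation). -/
def IsPartitionShape (s : Set Cell) : Prop :=
  s.Finite ∧ (∀ c ∈ s, 1 ≤ c.1 ∧ 1 ≤ c.2) ∧
    ∀ i j i' j' : ℕ, (i, j) ∈ s → 1 ≤ i' → i' ≤ i → 1 ≤ j' → j' ≤ j → (i', j') ∈ s

/-- Entries of mixed tableaux: `al k` represents `α_k`, `be k` represents `β_k`. -/
inductive MEntry : Type
  | al (k : ℤ)
  | be (k : ℤ)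
  deriving DecidableEq

/-- The index of a mixed entry. -/
def MEntry.idx : MEntry → ℤ
  | .al k => k
  | .be k => k

def MEntry.isAlpha : MEntry → Prop
  | .al _ => True
  | .be _ => False

def MEntry.isBeta : MEntry → Prop
  | .al _ => False
  | .be _ => True

/-- A mixed tableau: a partial filling of cells with mixed entries. -/
abbrev MixedTableau : Type := Cell → Option MEntry

/-- The set of cells filled in a mixed tableau. -/
def mshape (T : MixedTableau) : Set Cell := {c | T c ≠ none}

/-- A legal mixed tableau: finitely many cells, all in the positive quadrant,
and indices of `α` entries are positive. -/
def IsMixedTableau (T : MixedTableau) : Prop :=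
  (mshape T).Finite ∧ (∀ c ∈ mshape T, 1 ≤ c.1 ∧ 1 ≤ c.2) ∧
    ∀ c k, T c = some (MEntry.al k) → 0 < k

/-- `T` is a filling of the skew shape `mu / lam`. -/
def HasSkewShape (T : MixedTableau) (lam mu : Set Cell) : Prop :=
  IsPartitionShape lam ∧ IsPartitionShape mu ∧ lam ⊆ mu ∧ mshape T = mu \ lam

/-- `γ`-column-strictness for the entries selected by `p`:
indices weakly decrease to the northeast, and no two selected entries in the
same column have equal indices. -/
def ColumnStrictFor (p : MEntry → Prop) (T : MixedTableau) : Prop :=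
  (∀ c c' e e', T c = some e → T c' = some e' → p e → p e' →
      c.1 ≤ c'.1 → c.2 ≤ c'.2 → MEntry.idx e' ≤ MEntry.idx e) ∧
  (∀ c c' e e', T c = some e → T c' = some e' → p e → p e' →
      c.2 = c'.2 → c ≠ c' → MEntry.idx e ≠ MEntry.idx e')

/-- `γ`-row-strictness for the entries selected by `p`. -/
def RowStrictFor (p : MEntry → Prop) (T : MixedTableau) : Prop :=
  (∀ c c' e e', T c = some e → T c' = some e' → p e → p e' →
      c.1 ≤ c'.1 → c.2 ≤ c'.2 → MEntry.idx e' ≤ MEntry.idx e) ∧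
  (∀ c c' e e', T c = some e → T c' = some e' → p e → p e' →
      c.1 = c'.1 → c ≠ c' → MEntry.idx e ≠ MEntry.idx e')

def AlphaColumnStrict (T : MixedTableau) : Prop := ColumnStrictFor MEntry.isAlpha T
def AlphaRowStrict (T : MixedTableau) : Prop := RowStrictFor MEntry.isAlpha T
def BetaColumnStrict (T : MixedTableau) : Prop := ColumnStrictFor MEntry.isBeta T
def BetaRowStrict (T : MixedTableau) : Prop := RowStrictFor MEntry.isBeta T

def alphaCells (T : MixedTableau) : Set Cell := {c | ∃ k, T c = some (MEntry.al k)}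
def betaCells (T : MixedTableau) : Set Cell := {c | ∃ k, T c = some (MEntry.be k)}

/-- `(α,β)`-sortedness relative to the skew shape `mu / lam`: the `α`-cells form
`nu / lam` and the `β`-cells form `mu / nu` for some partition `nu`. -/
def ABSortedShape (T : MixedTableau) (lam mu : Set Cell) : Prop :=
  ∃ nu : Set Cell, IsPartitionShape nu ∧ lam ⊆ nu ∧ nu ⊆ mu ∧
    alphaCells T = nu \ lam ∧ betaCells T = mu \ nu

/-- `(α,β)`-sorted. -/
def ABSorted (T : MixedTableau) : Prop :=
  ∃ lam mu : Set Cell, HasSkewShape T lam mu ∧ ABSortedShape T lam mu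

/-- `(β,α)`-sortedness relative to the skew shape `mu / lam`. -/
def BASortedShape (T : MixedTableau) (lam mu : Set Cell) : Prop :=
  ∃ nu : Set Cell, IsPartitionShape nu ∧ lam ⊆ nu ∧ nu ⊆ mu ∧
    betaCells T = nu \ lam ∧ alphaCells T = mu \ nu

/-- `(β,α)`-sorted. -/
def BASorted (T : MixedTableau) : Prop :=
  ∃ lam mu : Set Cell, HasSkewShape T lam mu ∧ BASortedShape T lam mu

/-- Interchange the contents of two cells. -/
def swapCells (T : MixedTableau) (c c' : Cell) : MixedTableau :=
  Function.update (Function.update T c (T c')) c' (T c)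

/-- A switch: interchange an `α_r` with a `β_s` directly to its right or
directly above it, provided both the source and the result are
`α`-column-strict and `β`-row-strict. -/
def Switch (T T' : MixedTableau) : Prop :=
  AlphaColumnStrict T ∧ BetaRowStrict T ∧
  ∃ c c' : Cell, (c' = rtCell c ∨ c' = upCell c) ∧
    (∃ r, T c = some (MEntry.al r)) ∧ (∃ s, T c' = some (MEntry.be s)) ∧
    T' = swapCells T c c' ∧ AlphaColumnStrict T' ∧ BetaRowStrict T'

/-- Fully switched: no switch is possible. -/
def FullySwitched (T : MixedTableau) : Prop := ¬ ∃ T', Switch T T'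

/-- The cell `c` contains a `β` entry. -/
def isBetaCell (T : MixedTableau) (c : Cell) : Prop := ∃ k, T c = some (MEntry.be k)

/-- One step of the switching process of the shuffle: the `α` entry at `c`
moves to the cell `c'` (above or to the right), following the tie-breaking
rule of the jeu de taquin shuffle. -/
def ShuffMoveTo (Q : MixedTableau) (c c' : Cell) (Q' : MixedTableau) : Prop :=
  (∃ i, Q c = some (MEntry.al i)) ∧ Q' = swapCells Q c c' ∧
  ((isBetaCell Q (rtCell c) ∧ ¬ isBetaCell Q (upCell c) ∧ c' = rtCell c) ∨
   (isBetaCell Q (upCell c) ∧ ¬ isBetaCell Q (rtCell c) ∧ c' = upCell c) ∨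
   (∃ k j, Q (upCell c) = some (MEntry.be k) ∧ Q (rtCell c) = some (MEntry.be j) ∧
      ((j < k ∧ c' = upCell c) ∨ (k ≤ j ∧ c' = rtCell c))))

/-- The `α` entry at `c` is settled: the cells above and to the right of it
contain `α` entries or are empty. -/
def ShuffSettled (Q : MixedTableau) (c : Cell) : Prop :=
  ¬ isBetaCell Q (upCell c) ∧ ¬ isBetaCell Q (rtCell c)

/-- The full switching process of a single chosen `α` entry, starting at cell `c`,
until it is settled. -/
inductive ShuffTrack : MixedTableau → Cell → MixedTableau → Prop
  | done : ∀ Q c, ShuffSettled Q c → ShuffTrack Q c Q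
  | step : ∀ Q c c' Q' R, ShuffMoveTo Q c c' Q' → ShuffTrack Q' c' R → ShuffTrack Q c R

/-- The cell `c` holds an `α` entry having a `β` entry directly above or
directly to its right. -/
def ShuffPending (Q : MixedTableau) (c : Cell) : Prop :=
  (∃ i, Q c = some (MEntry.al i)) ∧ (isBetaCell Q (upCell c) ∨ isBetaCell Q (rtCell c))

/-- Among the pending `α` entries, the rightmost one with the smallest index. -/
def ShuffChosen (Q : MixedTableau) (c : Cell) : Prop :=
  ShuffPending Q c ∧ ∃ i, Q c = some (MEntry.al i) ∧
    (∀ c' i', ShuffPending Q c' → Q c' = some (MEntry.al i') → i ≤ i') ∧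
    (∀ c', ShuffPending Q c' → Q c' = some (MEntry.al i) → c'.2 ≤ c.2)

/-- `ShuffRel Q R` means `R = shuff(Q)`, the jeu de taquin shuffle of `Q`. -/
inductive ShuffRel : MixedTableau → MixedTableau → Prop
  | done : ∀ Q, (∀ c, ¬ ShuffPending Q c) → ShuffRel Q Q
  | step : ∀ Q c Q' R, ShuffChosen Q c → ShuffTrack Q c Q' → ShuffRel Q' R → ShuffRel Q R

/-- The entry `α_r` at `c` is out of order via its right neighbour. -/
def OutOfOrderH (T : MixedTableau) (c : Cell) : Prop :=
  ∃ r s : ℤ, T c = some (MEntry.al r) ∧ T (rtCell c) = some (MEntry.be s) ∧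
    r < s + ((c.2 : ℤ) + 1) - (c.1 : ℤ)

/-- The entry `α_r` at `c` is out of order via its upper neighbour. -/
def OutOfOrderV (T : MixedTableau) (c : Cell) : Prop :=
  ∃ r t : ℤ, T c = some (MEntry.al r) ∧ T (upCell c) = some (MEntry.be t) ∧
    r ≤ t + (c.2 : ℤ) - ((c.1 : ℤ) + 1)

def OutOfOrder (T : MixedTableau) (c : Cell) : Prop := OutOfOrderH T c ∨ OutOfOrderV T c

/-- The GG-jdt slide at the cell `c`. -/
def GGSlide (T : MixedTableau) (c : Cell) (T' : MixedTableau) : Prop :=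
  (OutOfOrderH T c ∧ ¬ OutOfOrderV T c ∧ T' = swapCells T c (rtCell c)) ∨
  (OutOfOrderV T c ∧ ¬ OutOfOrderH T c ∧ T' = swapCells T c (upCell c)) ∨
  (OutOfOrderH T c ∧ OutOfOrderV T c ∧
    ∃ s t : ℤ, T (rtCell c) = some (MEntry.be s) ∧ T (upCell c) = some (MEntry.be t) ∧
      ((t ≤ s ∧ T' = swapCells T c (rtCell c)) ∨ (s < t ∧ T' = swapCells T c (upCell c))))

/-- The cell chosen by the GG-jdt map: the rightmost cell containing an
out-of-order `α_r` with `r` smallest. -/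
def GGChosen (T : MixedTableau) (c : Cell) : Prop :=
  ∃ r : ℤ, T c = some (MEntry.al r) ∧ OutOfOrder T c ∧
    (∀ c' r', T c' = some (MEntry.al r') → OutOfOrder T c' → r ≤ r') ∧
    (∀ c', T c' = some (MEntry.al r) → OutOfOrder T c' → c'.2 ≤ c.2)

/-- One iteration of the GG-jdt map. -/
def GGStep (T T' : MixedTableau) : Prop := ∃ c, GGChosen T c ∧ GGSlide T c T'

/-- `GGRel T R` means `R = jdt_GG(T)`. -/
def GGRel (T R : MixedTableau) : Prop :=
  Relation.ReflTransGen GGStep T R ∧ ∀ c, ¬ OutOfOrder R c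

/-- `c_β^+`: replace each `β_r` in a cell of content `c = j - i` by `β_{r+c}`. -/
def cBetaPlus (T : MixedTableau) : MixedTableau := fun c =>
  match T c with
  | some (MEntry.be r) => some (MEntry.be (r + ((c.2 : ℤ) - (c.1 : ℤ))))
  | o => o

/-- Totally column-strict: indices strictly decrease up columns and weakly
decrease along rows. -/
def TotallyColumnStrict (T : MixedTableau) : Prop :=
  (∀ c e e', T c = some e → T (upCell c) = some e' → MEntry.idx e' < MEntry.idx e) ∧
  (∀ c e e', T c = some e → T (rtCell c) = some e' → MEntry.idx e' ≤ MEntry.idx e)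

/-- Flagged-mixed tableau: `α_k` in column `j` forces `0 < k < j`, and
`β_k` in row `i` forces `0 < k < i`. -/
def IsFMT (T : MixedTableau) : Prop :=
  (∀ c k, T c = some (MEntry.al k) → 0 < k ∧ k < (c.2 : ℤ)) ∧
  (∀ c k, T c = some (MEntry.be k) → 0 < k ∧ k < (c.1 : ℤ))

/-- Exquisite tableau of shape `mu / lam`. -/
def IsEXQ (lam mu : Set Cell) (E : MixedTableau) : Prop :=
  IsMixedTableau E ∧ HasSkewShape E lam mu ∧ IsFMT E ∧
    TotallyColumnStrict (cBetaPlus E)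

/-- Biflagged tableau of shape `mu / lam`. -/
def IsBFT (lam mu : Set Cell) (Q : MixedTableau) : Prop :=
  IsMixedTableau Q ∧ HasSkewShape Q lam mu ∧
  AlphaColumnStrict Q ∧ BetaRowStrict Q ∧ ABSortedShape Q lam mu ∧
  IsFMT Q ∧ (∃ R, ShuffRel Q R) ∧ (∀ R, ShuffRel Q R → IsFMT R)

/-- Number of occurrences of the entry `e` in the mixed tableau `Q`:
the exponent of the corresponding variable in `wt(Q)`. -/
noncomputable def mcount (Q : MixedTableau) (e : MEntry) : ℕ :=
  Set.ncard {c | Q c = some e}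

/-! ### Hook-valued tableaux -/

/-- A hook: a hook entry, a list of leg entries and a list of arm entries. -/
structure Hook : Type where
  hk : ℕ
  legs : List ℕ
  arms : List ℕ
  deriving DecidableEq

/-- Valid hook: positive entries, `hk < L₁ < ⋯ < L_ℓ` and `hk ≤ A₁ ≤ ⋯ ≤ A_k`. -/
def Hook.Valid (H : Hook) : Prop :=
  1 ≤ H.hk ∧ H.legs.Chain' (· < ·) ∧ (∀ x ∈ H.legs, H.hk < x) ∧
  H.arms.Chain' (· ≤ ·) ∧ ∀ x ∈ H.arms, H.hk ≤ x

/-- The multiset of all entries of a hook. -/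
def Hook.entries (H : Hook) : Multiset ℕ :=
  H.hk ::ₘ ((H.legs : Multiset ℕ) + (H.arms : Multiset ℕ))

/-- A hook-valued filling. -/
abbrev HVTab : Type := Cell → Option Hook

def hshape (T : HVTab) : Set Cell := {c | T c ≠ none}

noncomputable def hsize (T : HVTab) : ℕ := (hshape T).ncard

def hentriesAt (T : HVTab) (c : Cell) : Multiset ℕ :=
  match T c with
  | some H => H.entries
  | none => 0

def armsAt (T : HVTab) (c : Cell) : List ℕ :=
  match T c with
  | some H => H.arms
  | none => []

def legsAt (T : HVTab) (c : Cell) : List ℕ :=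
  match T c with
  | some H => H.legs
  | none => []

/-- Hook-valued tableau: partition shape, valid hooks, rows weakly increasing
(entrywise) and columns strictly increasing (entrywise). -/
def IsHVT (T : HVTab) : Prop :=
  IsPartitionShape (hshape T) ∧
  (∀ c H, T c = some H → H.Valid) ∧
  (∀ c, ∀ x ∈ hentriesAt T c, ∀ y ∈ hentriesAt T (rtCell c), x ≤ y) ∧
  (∀ c, ∀ x ∈ hentriesAt T c, ∀ y ∈ hentriesAt T (upCell c), x < y)

def NoArms (T : HVTab) : Prop := ∀ c, armsAt T c = []
def NoLegs (T : HVTab) : Prop := ∀ c, legsAt T c = []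

/-- Insert into a sorted list. -/
def insSorted (x : ℕ) : List ℕ → List ℕ
  | [] => [x]
  | y :: ys => if x ≤ y then x :: y :: ys else y :: insSorted x ys

def insSortedAll (xs : List ℕ) (l : List ℕ) : List ℕ :=
  xs.foldl (fun acc x => insSorted x acc) l

/-- In arm-uncrowding, the receiving cell's hook: replace its entry `k`
(the smallest entry `≥ a`) by `a` and insert `k` as an arm entry. -/
def Hook.receiveArm (H : Hook) (a k : ℕ) : Hook :=
  if H.hk = k then ⟨a, H.legs, insSorted k H.arms⟩
  else if k ∈ H.legs then ⟨H.hk, insSorted a (H.legs.erase k), insSorted k H.arms⟩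
  else ⟨H.hk, H.legs, insSorted a H.arms⟩

/-- In leg-uncrowding, the receiving cell's hook: replace its entry `k`
(the smallest entry `> l`) by `l` and insert `k` as a leg entry. -/
def Hook.receiveLeg (H : Hook) (l k : ℕ) : Hook :=
  if H.hk = k then ⟨l, insSorted k H.legs, H.arms⟩
  else if k ∈ H.legs then ⟨H.hk, insSorted l H.legs, H.arms⟩
  else ⟨H.hk, insSorted k H.legs, insSorted l (H.arms.erase k)⟩

/-- Add the arm entries `xs` to the cell `c` of `T`. -/
def addArmsAt (T : HVTab) (c : Cell) (xs : List ℕ) : HVTab :=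
  if xs = [] then T
  else
    match T c with
    | some H => Function.update T c (some ⟨H.hk, H.legs, insSortedAll xs H.arms⟩)
    | none => Function.update T c (some ⟨xs.headI, [], xs.tail⟩)

/-- The arm entry selected by arm-uncrowding: `a` is the largest arm entry in
the rightmost column `c` containing an arm entry, located in cell `(r, c)`. -/
def SelectedArm (T : HVTab) (r c a : ℕ) : Prop :=
  a ∈ armsAt T (r, c) ∧
  (∀ r' x, x ∈ armsAt T (r', c) → x ≤ a) ∧
  (∀ r' c', c < c' → armsAt T (r', c') = [])

/-- The leg entry selected by leg-uncrowding: `l` is the largest leg entry in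
the topmost row `r` containing a leg entry, located in cell `(r, c)`. -/
def SelectedLeg (T : HVTab) (r c l : ℕ) : Prop :=
  l ∈ legsAt T (r, c) ∧
  (∀ c' x, x ∈ legsAt T (r, c') → x ≤ l) ∧
  (∀ r' c', r < r' → legsAt T (r', c') = [])

/-- `k` is the smallest entry `≥ a` in column `col`, located in row `rr`. -/
def SmallestGE (T : HVTab) (col a k rr : ℕ) : Prop :=
  k ∈ hentriesAt T (rr, col) ∧ a ≤ k ∧
  ∀ r' y, y ∈ hentriesAt T (r', col) → a ≤ y → k ≤ y

/-- `k` is the smallest entry `> l` in row `row`, located in column `cc`. -/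
def SmallestGT (T : HVTab) (row l k cc : ℕ) : Prop :=
  k ∈ hentriesAt T (row, cc) ∧ l < k ∧
  ∀ c' y, y ∈ hentriesAt T (row, c') → l < y → k ≤ y

/-- The arm-uncrowding bumping `A_b`. -/
def ArmBumpRel (T T' : HVTab) : Prop :=
  (NoArms T ∧ T' = T) ∨
  (∃ r c a H, T (r, c) = some H ∧ SelectedArm T r c a ∧
    ((∃ k rr HT, SmallestGE T (c + 1) a k rr ∧ T (rr, c + 1) = some HT ∧
        ((rr ≠ r ∧
            T' = Function.update (Function.update T (r, c)
                (some ⟨H.hk, H.legs, H.arms.erase a⟩)) (rr, c + 1)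
                (some (Hook.receiveArm HT a k))) ∨
         (rr = r ∧
            T' = Function.update (Function.update T (r, c)
                (some ⟨H.hk, H.legs.filter (fun x => decide (x ≤ a)), H.arms.erase a⟩))
                (r, c + 1)
                (some ⟨(Hook.receiveArm HT a k).hk,
                       insSortedAll (H.legs.filter (fun x => decide (a < x)))
                         (Hook.receiveArm HT a k).legs,
                       (Hook.receiveArm HT a k).arms⟩)))) ∨
     ((∀ r' y, y ∈ hentriesAt T (r', c + 1) → y < a) ∧
        ∃ t, 1 ≤ t ∧ (∀ r', (r', c + 1) ∈ hshape T ↔ 1 ≤ r' ∧ r' < t) ∧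
        ((t ≠ r ∧
            T' = Function.update (Function.update T (r, c)
                (some ⟨H.hk, H.legs, H.arms.erase a⟩)) (t, c + 1)
                (some ⟨a, [], []⟩)) ∨
         (t = r ∧
            T' = Function.update (Function.update T (r, c)
                (some ⟨H.hk, H.legs.filter (fun x => decide (x ≤ a)), H.arms.erase a⟩))
                (r, c + 1)
                (some ⟨a, H.legs.filter (fun x => decide (a < x)), []⟩))))))

/-- The leg-uncrowding bumping `L_b`. -/
def LegBumpRel (T T' : HVTab) : Prop :=
  (NoLegs T ∧ T' = T) ∨
  (∃ r c l H, T (r, c) = some H ∧ SelectedLeg T r c l ∧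
    ((∃ k cc HT, SmallestGT T (r + 1) l k cc ∧ T (r + 1, cc) = some HT ∧
        ((cc ≠ c ∧
            T' = Function.update (Function.update T (r, c)
                (some ⟨H.hk, H.legs.erase l, H.arms⟩)) (r + 1, cc)
                (some (Hook.receiveLeg HT l k))) ∨
         (cc = c ∧
            T' = addArmsAt
              (Function.update (Function.update T (r, c)
                  (some ⟨H.hk, H.legs.erase l, H.arms.filter (fun x => decide (l < x))⟩))
                  (r + 1, c) (some (Hook.receiveLeg HT l k)))
              (r, c + 1) (H.arms.filter (fun x => decide (x ≤ l)))))) ∨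
     ((∀ c' y, y ∈ hentriesAt T (r + 1, c') → y ≤ l) ∧
        ∃ t, 1 ≤ t ∧ (∀ c', (r + 1, c') ∈ hshape T ↔ 1 ≤ c' ∧ c' < t) ∧
        ((t ≠ c ∧
            T' = Function.update (Function.update T (r, c)
                (some ⟨H.hk, H.legs.erase l, H.arms⟩)) (r + 1, t)
                (some ⟨l, [], []⟩)) ∨
         (t = c ∧
            T' = Function.update (Function.update T (r, c)
                (some ⟨H.hk, H.legs.erase l, H.arms.filter (fun x => decide (l < x))⟩))
                (r + 1, c)
                (some ⟨l, [], H.arms.filter (fun x => decide (x ≤ l))⟩))))))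

/-- `n`-fold composition of a relation. -/
def RelPow {α : Type*} (R : α → α → Prop) : ℕ → α → α → Prop
  | 0, a, b => a = b
  | n + 1, a, b => ∃ x, R a x ∧ RelPow R n x b

/-- The single-arm-uncrowding map `𝒜`. -/
def ArmRel (T T' : HVTab) : Prop :=
  (NoArms T ∧ T' = T) ∨
  (¬ NoArms T ∧ ∃ m : ℕ, RelPow ArmBumpRel m T T' ∧ hsize T' = hsize T + 1 ∧
    ∀ m' U, m' < m → RelPow ArmBumpRel m' T U → hsize U = hsize T)

/-- The single-leg-uncrowding map `ℒ`. -/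
def LegRel (T T' : HVTab) : Prop :=
  (NoLegs T ∧ T' = T) ∨
  (¬ NoLegs T ∧ ∃ m : ℕ, RelPow LegBumpRel m T T' ∧ hsize T' = hsize T + 1 ∧
    ∀ m' U, m' < m → RelPow LegBumpRel m' T U → hsize U = hsize T)

/-- The two kinds of uncrowding operators. -/
inductive Bump : Type
  | A
  | L
  deriving DecidableEq

def BumpRel : Bump → HVTab → HVTab → Prop
  | .A => ArmBumpRel
  | .L => LegBumpRel

/-- `T` has type `f_k^{(ε_k)} ⋯ f_1^{(ε_1)}`; the word is given as the list
`[(f_1, ε_1), …, (f_k, ε_k)]` in order of application. -/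
def HasType : HVTab → List (Bump × ℕ) → Prop
  | _, [] => True
  | T, (f, e) :: w => ∃ T', BumpRel f T T' ∧ hsize T' = hsize T + e ∧ HasType T' w

def StepRel : Bump → HVTab → HVTab → Prop
  | .A => ArmRel
  | .L => LegRel

def SelectedArmCol (T : HVTab) (c : ℕ) : Prop := ∃ r a, SelectedArm T r c a
def SelectedLegRow (T : HVTab) (r : ℕ) : Prop := ∃ c l, SelectedLeg T r c l

/-- The recorded entry of one uncrowding step applied to `T`. -/
def StepEntry : Bump → HVTab → MEntry → Prop
  | .A, T, e => ∃ c : ℕ, SelectedArmCol T c ∧ e = MEntry.al (c : ℤ)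
  | .L, T, e => ∃ r : ℕ, SelectedLegRow T r ∧ e = MEntry.be (r : ℤ)

/-- `UncrowdRec w T P Q` means `𝒰_w(T) = (P, Q)`, where `w` is the word listed
in order of application. -/
def UncrowdRec : List Bump → HVTab → HVTab → MixedTableau → Prop
  | [], T, P, Q => P = T ∧ ∀ c, Q c = none
  | f :: w, T, P, Q => ∃ T' Q', StepRel f T T' ∧ UncrowdRec w T' P Q' ∧
      (∀ cell, cell ∈ hshape T' → cell ∉ hshape T →
        ∃ e, StepEntry f T e ∧ Q cell = some e) ∧
      (∀ cell, ¬ (cell ∈ hshape T' ∧ cell ∉ hshape T) → Q cell = Q' cell)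

/-- `𝒰_{ℒ^∞𝒜^∞}(T) = (P, Q)`. -/
def UncrowdLAinf (T P : HVTab) (Q : MixedTableau) : Prop :=
  ∃ M N : ℕ, UncrowdRec (List.replicate M Bump.A ++ List.replicate N Bump.L) T P Q ∧
    NoArms P ∧ NoLegs P

/-- `𝒰_{𝒜^∞ℒ^∞}(T) = (P, Q)`. -/
def UncrowdALinf (T P : HVTab) (Q : MixedTableau) : Prop :=
  ∃ M N : ℕ, UncrowdRec (List.replicate N Bump.L ++ List.replicate M Bump.A) T P Q ∧
    NoArms P ∧ NoLegs P

/-- A semistandard Young tableau, seen as a hook-valued tableau all of whose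
hooks have no arm and no leg entries. -/
def IsSSYT (P : HVTab) : Prop := IsHVT P ∧ NoArms P ∧ NoLegs P

/-- Number of arm entries in column `j` of `T`: the exponent of `α_j` in `wt(T)`. -/
noncomputable def armCountCol (T : HVTab) (j : ℕ) : ℕ := ∑ᶠ i : ℕ, (armsAt T (i, j)).length

/-- Number of leg entries in row `i` of `T`: the exponent of `β_i` in `wt(T)`. -/
noncomputable def legCountRow (T : HVTab) (i : ℕ) : ℕ := ∑ᶠ j : ℕ, (legsAt T (i, j)).length

/-- Number of entries of `T` equal to `v`: the exponent of `x_v` in `wt(T)`. -/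
noncomputable def entryCount (T : HVTab) (v : ℕ) : ℕ := ∑ᶠ c : Cell, (hentriesAt T c).count v

noncomputable def armCountColZ (T : HVTab) (k : ℤ) : ℕ :=
  if 0 ≤ k then armCountCol T k.toNat else 0

noncomputable def legCountRowZ (T : HVTab) (k : ℤ) : ℕ :=
  if 0 ≤ k then legCountRow T k.toNat else 0

/-- `wt(T) = wt(P) · wt(Q)` for a hook-valued tableau `T`, a semistandard
Young tableau `P` (as a hook-valued tableau) and a mixed tableau `Q`. -/
def WtEq (T P : HVTab) (Q : MixedTableau) : Prop :=
  (∀ j : ℕ, armCountCol T j = mcount Q (MEntry.al (j : ℤ))) ∧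
  (∀ i : ℕ, legCountRow T i = mcount Q (MEntry.be (i : ℤ))) ∧
  (∀ k : ℤ, k ≤ 0 → mcount Q (MEntry.al k) = 0 ∧ mcount Q (MEntry.be k) = 0) ∧
  (∀ v : ℕ, entryCount T v = entryCount P v)

namespace GGJdt

/-- The cell `c'` is the right or the upper neighbour of the cell `c`. -/
def Adj (c c' : Cell) : Prop := c' = rtCell c ∨ c' = upCell c

lemma adj_iff {c c' : Cell} :
    Adj c c' ↔ (c'.1 = c.1 ∧ c'.2 = c.2 + 1) ∨ (c'.1 = c.1 + 1 ∧ c'.2 = c.2) := by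
  simp [Adj, rtCell, upCell, Prod.ext_iff]

lemma rtCell_fst (c : Cell) : (rtCell c).1 = c.1 := rfl
lemma rtCell_snd (c : Cell) : (rtCell c).2 = c.2 + 1 := rfl
lemma upCell_fst (c : Cell) : (upCell c).1 = c.1 + 1 := rfl
lemma upCell_snd (c : Cell) : (upCell c).2 = c.2 := rfl

lemma adj_rtCell (c : Cell) : Adj c (rtCell c) := Or.inl rfl
lemma adj_upCell (c : Cell) : Adj c (upCell c) := Or.inr rfl

/-- The amount by which the content-shifted index of a `β_s` exceeds `r`, measured on the
pair of adjacent cells `c`, `c'`. The entry `α_r` in `c` is out of order with respect to `β_s`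
in `c'` if and only if this number is positive. -/
def gap (c c' : Cell) (r s : ℤ) : ℤ := s + c'.2 - c.1 - r

/-- `α_r` in the cell `c` and an adjacent `β` to its north-east have gap in `A`. For `A` the set
of positive integers this means out of order, for `A = univ` pending in the shuffle. -/
def OO (A : Set ℤ) (T : MixedTableau) (c : Cell) (r : ℤ) : Prop :=
  T c = some (.al r) ∧ ∃ c' s, Adj c c' ∧ T c' = some (.be s) ∧ gap c c' r s ∈ A

/-- Every `α` directly to the north-east of a `β` has gap in `A`. -/
def Passed (A : Set ℤ) (T : MixedTableau) : Prop :=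
  ∀ c c' r s, Adj c c' → T c = some (.be s) → T c' = some (.al r) → gap c c' r s ∈ A

/-- An `α`-column-strict and `β`-row-strict filling of `S`. -/
structure Good (S : Set Cell) (T : MixedTableau) : Prop where
  shape : mshape T = S
  alphaCS : AlphaColumnStrict T
  betaRS : BetaRowStrict T

/-- Every cell of the rectangle spanned by two cells of `S` belongs to `S`. -/
def Conv (S : Set Cell) : Prop :=
  ∀ c c' x : Cell, c ∈ S → c' ∈ S → c.1 ≤ x.1 → c.2 ≤ x.2 → x.1 ≤ c'.1 → x.2 ≤ c'.2 → x ∈ S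

variable {S : Set Cell} {T T' : MixedTableau} {A B : Set ℤ} {c c' x y : Cell} {r s k l : ℤ}

lemma al_be (h : T c = some (.al r)) : ¬ T c = some (.be s) := by simp [h]

namespace Good

lemma al_le (h : Good S T) (hx : T x = some (.al k)) (hy : T y = some (.al l))
    (h1 : x.1 ≤ y.1) (h2 : x.2 ≤ y.2) : l ≤ k :=
  h.alphaCS.1 x y _ _ hx hy trivial trivial h1 h2

lemma al_lt (h : Good S T) (hx : T x = some (.al k)) (hy : T y = some (.al l))
    (h1 : x.1 < y.1) (h2 : x.2 = y.2) : l < k :=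
  lt_of_le_of_ne (h.al_le hx hy h1.le h2.le) fun e =>
    h.alphaCS.2 x y _ _ hx hy trivial trivial h2 (by rintro rfl; omega) e.symm

lemma be_le (h : Good S T) (hx : T x = some (.be k)) (hy : T y = some (.be l))
    (h1 : x.1 ≤ y.1) (h2 : x.2 ≤ y.2) : l ≤ k :=
  h.betaRS.1 x y _ _ hx hy trivial trivial h1 h2

lemma be_lt (h : Good S T) (hx : T x = some (.be k)) (hy : T y = some (.be l))
    (h1 : x.1 = y.1) (h2 : x.2 < y.2) : l < k :=
  lt_of_le_of_ne (h.be_le hx hy h1.le h2.le) fun e =>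
    h.betaRS.2 x y _ _ hx hy trivial trivial h1 (by rintro rfl; omega) e.symm

lemma of_lt (hS : mshape T = S)
    (a1 : ∀ x y k l, T x = some (.al k) → T y = some (.al l) → x.1 ≤ y.1 → x.2 ≤ y.2 → l ≤ k)
    (a2 : ∀ x y k l, T x = some (.al k) → T y = some (.al l) → x.1 < y.1 → x.2 = y.2 → l < k)
    (b1 : ∀ x y k l, T x = some (.be k) → T y = some (.be l) → x.1 ≤ y.1 → x.2 ≤ y.2 → l ≤ k)
    (b2 : ∀ x y k l, T x = some (.be k) → T y = some (.be l) → x.1 = y.1 → x.2 < y.2 → l < k) :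
    Good S T := by
  refine ⟨hS, ⟨?_, ?_⟩, ⟨?_, ?_⟩⟩
  · rintro x y (k | k) (l | l) hx hy hp hq h1 h2
    · exact a1 x y k l hx hy h1 h2
    all_goals first | exact hp.elim | exact hq.elim
  · rintro x y (k | k) (l | l) hx hy hp hq h1 h2
    · rcases lt_trichotomy x.1 y.1 with h | h | h
      · exact (a2 x y k l hx hy h h1).ne'
      · exact absurd (Prod.ext h h1) h2
      · exact (a2 y x l k hy hx h h1.symm).ne
    all_goals first | exact hp.elim | exact hq.elim
  · rintro x y (k | k) (l | l) hx hy hp hq h1 h2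
    · exact hp.elim
    · exact hp.elim
    · exact hq.elim
    · exact b1 x y k l hx hy h1 h2
  · rintro x y (k | k) (l | l) hx hy hp hq h1 h2
    · exact hp.elim
    · exact hp.elim
    · exact hq.elim
    · rcases lt_trichotomy x.2 y.2 with h | h | h
      · exact (b2 x y k l hx hy h1 h).ne'
      · exact absurd (Prod.ext h1 h) h2
      · exact (b2 y x l k hy hx h1.symm h).ne

lemma mem (h : Good S T) {e : MEntry} (hx : T x = some e) : x ∈ S := by
  rw [← h.shape]; simp [mshape, hx]

lemma entry (h : Good S T) (hx : x ∈ S) :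
    (∃ k, T x = some (.al k)) ∨ ∃ k, T x = some (.be k) := by
  rw [← h.shape] at hx
  obtain ⟨e, he⟩ := Option.ne_none_iff_exists'.1 hx
  rcases e with k | k
  · exact Or.inl ⟨k, he⟩
  · exact Or.inr ⟨k, he⟩

/-- Going up a column from an `α` to a `β`, one meets an `α` directly below a `β`. -/
lemma colRun (h : Good S T) (hS : Conv S) :
    ∀ {n : ℕ} {c c' : Cell} {r t : ℤ}, T c = some (.al r) → T c' = some (.be t) → c.2 = c'.2 →
      c'.1 = c.1 + n → ∃ a p u, T a = some (.al p) ∧ T (upCell a) = some (.be u) ∧ a.2 = c.2 ∧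
        c.1 ≤ a.1 ∧ a.1 < c'.1 ∧ t ≤ u ∧ p + a.1 ≤ r + c.1 := by
  intro n
  induction n with
  | zero =>
    intro c c' r t hc hc' h2 h1
    obtain rfl : c = c' := Prod.ext (by omega) h2
    exact absurd hc' (al_be hc)
  | succ n ih =>
    intro c c' r t hc hc' h2 h1
    have hu : upCell c ∈ S := hS c c' _ (h.mem hc) (h.mem hc')
      (by rw [upCell_fst]; omega) (by rw [upCell_snd]) (by rw [upCell_fst]; omega)
      (by rw [upCell_snd]; omega)
    rcases h.entry hu with ⟨k, hk⟩ | ⟨k, hk⟩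
    · have := h.al_lt hc hk (by rw [upCell_fst]; omega) (by rw [upCell_snd])
      obtain ⟨a, p, u, h1, h2, h3, h4, h5, h6, h7⟩ := ih hk hc' (by rw [upCell_snd]; omega)
        (by rw [upCell_fst]; omega)
      rw [upCell_fst] at h4 h7
      rw [upCell_snd] at h3
      exact ⟨a, p, u, h1, h2, h3, by omega, h5, h6, by push_cast at h7; omega⟩
    · exact ⟨c, r, k, hc, hk, rfl, le_rfl, by omega,
        h.be_le hk hc' (by rw [upCell_fst]; omega) (by rw [upCell_snd]; omega), le_rfl⟩

/-- Going right along a row from an `α` to a `β`, one meets an `α` directly left of a `β`. -/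
lemma rowRun (h : Good S T) (hS : Conv S) :
    ∀ {n : ℕ} {c c' : Cell} {r t : ℤ}, T c = some (.al r) → T c' = some (.be t) → c.1 = c'.1 →
      c'.2 = c.2 + n → ∃ a p u, T a = some (.al p) ∧ T (rtCell a) = some (.be u) ∧ a.1 = c.1 ∧
        c.2 ≤ a.2 ∧ a.2 < c'.2 ∧ t + c'.2 ≤ u + a.2 + 1 ∧ p ≤ r := by
  intro n
  induction n with
  | zero =>
    intro c c' r t hc hc' h2 h1
    obtain rfl : c = c' := Prod.ext h2 (by omega)
    exact absurd hc' (al_be hc)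
  | succ n ih =>
    intro c c' r t hc hc' h1 h2
    have hu : (c'.1, c.2 + n) ∈ S := hS c c' _ (h.mem hc) (h.mem hc')
      (by dsimp only; omega) (by dsimp only; omega) (by dsimp only; omega) (by dsimp only; omega)
    rcases h.entry hu with ⟨k, hk⟩ | ⟨k, hk⟩
    · refine ⟨(c'.1, c.2 + n), k, t, hk, ?_, h1.symm, by dsimp only; omega,
        by dsimp only; omega, by dsimp only; omega, h.al_le hc hk (by dsimp only; omega)
        (by dsimp only; omega)⟩
      rw [← hc']; congr 1; exact Prod.ext rfl (by rw [rtCell_snd]; dsimp only; omega)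
    · have := h.be_lt hk hc' rfl (by dsimp only; omega)
      obtain ⟨a, p, u, h1, h2, h3, h4, h5, h6, h7⟩ := ih hc hk (by dsimp only; omega) rfl
      dsimp only at h5 h6
      exact ⟨a, p, u, h1, h2, h3, h4, by omega, by push_cast at h6; omega, h7⟩

/-- Going right along a row from a `β` to an `α`, one meets a `β` directly left of an `α`. -/
lemma rowRun' (h : Good S T) (hS : Conv S) :
    ∀ {n : ℕ} {c c' : Cell} {r t : ℤ}, T c = some (.be t) → T c' = some (.al r) → c.1 = c'.1 →
      c'.2 = c.2 + n → ∃ a p u, T a = some (.be u) ∧ T (rtCell a) = some (.al p) ∧ a.1 = c.1 ∧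
        c.2 ≤ a.2 ∧ a.2 < c'.2 ∧ u + a.2 ≤ t + c.2 ∧ r ≤ p := by
  intro n
  induction n with
  | zero =>
    intro c c' r t hc hc' h2 h1
    obtain rfl : c = c' := Prod.ext h2 (by omega)
    exact absurd hc (al_be hc')
  | succ n ih =>
    intro c c' r t hc hc' h1 h2
    have hu : rtCell c ∈ S := hS c c' _ (h.mem hc) (h.mem hc')
      (by rw [rtCell_fst]) (by rw [rtCell_snd]; omega) (by rw [rtCell_fst]; omega)
      (by rw [rtCell_snd]; omega)
    rcases h.entry hu with ⟨k, hk⟩ | ⟨k, hk⟩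
    · exact ⟨c, k, t, hc, hk, rfl, le_rfl, by omega, le_rfl,
        h.al_le hk hc' (by rw [rtCell_fst]; omega) (by rw [rtCell_snd]; omega)⟩
    · have := h.be_lt hc hk (by rw [rtCell_fst]) (by rw [rtCell_snd]; omega)
      obtain ⟨a, p, u, h1, h2, h3, h4, h5, h6, h7⟩ := ih hk hc' (by rw [rtCell_fst]; omega)
        (by rw [rtCell_snd]; omega)
      rw [rtCell_snd] at h4 h6
      rw [rtCell_fst] at h3
      exact ⟨a, p, u, h1, h2, h3, by omega, h5, by push_cast at h6; omega, h7⟩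

/-- Two equal `α`s, one strictly south-west of the other, force an `α` of at most that index to
be out of order. -/
lemma exists_oo_of_strict_pair (h : Good S T) (hS : Conv S) (hA : IsUpperSet A)
    (hP : Passed A T) (hx : T x = some (.al k)) (hy : T y = some (.al k))
    (h1 : x.1 < y.1) (h2 : x.2 < y.2) : ∃ a p, OO A T a p ∧ p ≤ k := by
  have hz : (y.1, x.2) ∈ S := hS x y _ (h.mem hx) (h.mem hy) h1.le le_rfl le_rfl h2.le
  rcases h.entry hz with ⟨q, hq⟩ | ⟨q, hq⟩
  · have := h.al_lt hx hq h1 rfl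
    have := h.al_le hq hy le_rfl h2.le
    omega
  · obtain ⟨a, p, u, g1, g2, g3, g4, g5, g6, g7⟩ :=
      h.colRun hS (n := y.1 - x.1) hx hq rfl (by dsimp only; omega)
    obtain ⟨b, p', u', f1, f2, f3, f4, f5, f6, f7⟩ :=
      h.rowRun' hS (n := y.2 - x.2) hq hy rfl (by dsimp only; omega)
    refine ⟨a, p, ⟨g1, upCell a, u, adj_upCell a, g2, hA ?_ (hP _ _ _ _ (adj_rtCell b) f1 f2)⟩,
      by omega⟩
    dsimp only at f3 f4 f6 g5
    simp only [gap, upCell_snd, rtCell_snd]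
    push_cast
    omega

end Good

lemma cell_ne (h : x ≠ y) : x.1 ≠ y.1 ∨ x.2 ≠ y.2 := by
  by_contra h'
  push Not at h'
  exact h (Prod.ext h'.1 h'.2)

/-- `T'` arises from `T` by interchanging `α_r` in `c` and `β_s` in the adjacent cell `c'`. -/
structure Swap (T T' : MixedTableau) (c c' : Cell) (r s : ℤ) : Prop where
  adj : Adj c c'
  al : T c = some (.al r)
  be : T c' = some (.be s)
  eq : T' = swapCells T c c'

namespace Swap

lemma ne (h : Swap T T' c c' r s) : c ≠ c' := by
  rintro rfl
  exact al_be h.al h.be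

lemma apply_left (h : Swap T T' c c' r s) : T' c = some (.be s) := by
  rw [h.eq, swapCells, Function.update_of_ne h.ne, Function.update_self, h.be]

lemma apply_right (h : Swap T T' c c' r s) : T' c' = some (.al r) := by
  rw [h.eq, swapCells, Function.update_self, h.al]

lemma apply_of_ne (h : Swap T T' c c' r s) (h1 : x ≠ c) (h2 : x ≠ c') : T' x = T x := by
  rw [h.eq, swapCells, Function.update_of_ne h2, Function.update_of_ne h1]

lemma al_iff (h : Swap T T' c c' r s) :
    T' x = some (.al k) ↔ (x = c' ∧ k = r) ∨ (x ≠ c ∧ T x = some (.al k)) := by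
  by_cases h2 : x = c'
  · subst h2
    simp [h.apply_right, h.be, eq_comm]
  by_cases h1 : x = c
  · subst h1
    simp [h.apply_left, h2]
  simp [h.apply_of_ne h1 h2, h1, h2]

lemma be_iff (h : Swap T T' c c' r s) :
    T' x = some (.be k) ↔ (x = c ∧ k = s) ∨ (x ≠ c' ∧ T x = some (.be k)) := by
  by_cases h2 : x = c'
  · subst h2
    simp [h.apply_right, h.ne.symm]
  by_cases h1 : x = c
  · subst h1
    simp [h.apply_left, h.al, eq_comm]
  simp [h.apply_of_ne h1 h2, h1, h2]

lemma mshape_eq (h : Swap T T' c c' r s) : mshape T' = mshape T := by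
  ext x
  by_cases h2 : x = c'
  · subst h2
    simp [mshape, h.apply_right, h.be]
  by_cases h1 : x = c
  · subst h1
    simp [mshape, h.apply_left, h.al]
  simp [mshape, h.apply_of_ne h1 h2]

lemma mcount_eq (h : Swap T T' c c' r s) (e : MEntry) : mcount T' e = mcount T e := by
  have : {x | T' x = some e} = Equiv.swap c c' '' {x | T x = some e} := by
    ext x
    rw [Equiv.image_eq_preimage_symm, Equiv.symm_swap]
    simp only [Set.mem_ofPred_eq, Set.mem_preimage]
    by_cases h2 : x = c'
    · subst h2
      rw [Equiv.swap_apply_right, h.apply_right, h.al]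
    by_cases h1 : x = c
    · subst h1
      rw [Equiv.swap_apply_left, h.apply_left, h.be]
    rw [h.apply_of_ne h1 h2, Equiv.swap_apply_of_ne_of_ne h1 h2]
  rw [mcount, mcount, this, Set.ncard_image_of_injective _ (Equiv.injective _)]

end Swap

/-- A switch with gap in `A` between two good fillings of `S`. -/
def Move (S : Set Cell) (A : Set ℤ) (T T' : MixedTableau) : Prop :=
  Good S T ∧ Good S T' ∧ ∃ c c' r s, Swap T T' c c' r s ∧ gap c c' r s ∈ A

/-- Two switches at disjoint positions commute. -/
lemma good_of_commute {T1 T2 T3 : MixedTableau} {c1 c1' c2 c2' : Cell} {r1 s1 r2 s2 : ℤ}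
    (g : Good S T) (g1 : Good S T1) (g2 : Good S T2) (w1 : Swap T T1 c1 c1' r1 s1)
    (w2 : Swap T T2 c2 c2' r2 s2) (w3 : Swap T1 T3 c2 c2' r2 s2) (hne : c1 ≠ c2)
    (hne' : c1' ≠ c2') : Good S T3 := by
  have a1 := adj_iff.1 w1.adj
  have a2 := adj_iff.1 w2.adj
  have n12 : c1 ≠ c2' := by rintro rfl; exact al_be w1.al w2.be
  have n21 : c2 ≠ c1' := by rintro rfl; exact al_be w2.al w1.be
  have hal : ∀ x k, T3 x = some (.al k) → (x = c2' ∧ k = r2) ∨ (x = c1' ∧ k = r1) ∨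
      (x ≠ c1 ∧ x ≠ c2 ∧ T x = some (.al k)) := by
    intro x k hx
    have h1 := w3.al_iff.1 hx
    rw [w1.al_iff] at h1
    tauto
  have hbe : ∀ x k, T3 x = some (.be k) → (x = c2 ∧ k = s2) ∨ (x = c1 ∧ k = s1) ∨
      (x ≠ c1' ∧ x ≠ c2' ∧ T x = some (.be k)) := by
    intro x k hx
    have h1 := w3.be_iff.1 hx
    rw [w1.be_iff] at h1
    tauto
  have e11 := w1.apply_right
  have e12 := w1.apply_left
  have e21 := w2.apply_right
  have e22 := w2.apply_left
  have o1 : ∀ x k, x ≠ c1 → T x = some (.al k) → T1 x = some (.al k) :=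
    fun x k h1 h2 => w1.al_iff.2 (Or.inr ⟨h1, h2⟩)
  have o2 : ∀ x k, x ≠ c2 → T x = some (.al k) → T2 x = some (.al k) :=
    fun x k h1 h2 => w2.al_iff.2 (Or.inr ⟨h1, h2⟩)
  have p1 : ∀ x k, x ≠ c1' → T x = some (.be k) → T1 x = some (.be k) :=
    fun x k h1 h2 => w1.be_iff.2 (Or.inr ⟨h1, h2⟩)
  have p2 : ∀ x k, x ≠ c2' → T x = some (.be k) → T2 x = some (.be k) :=
    fun x k h1 h2 => w2.be_iff.2 (Or.inr ⟨h1, h2⟩)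
  have m1 := cell_ne hne
  have m2 := cell_ne hne'
  have m3 := cell_ne n12
  have m4 := cell_ne n21
  have f1 := o1 _ _ hne.symm w2.al
  have f2 := o2 _ _ hne w1.al
  have q1 := p1 _ _ hne'.symm w2.be
  have q2 := p2 _ _ hne' w1.be
  refine Good.of_lt (w3.mshape_eq.trans g1.shape) ?_ ?_ ?_ ?_
  · intro x y k l hx hy h1 h2
    rcases hal x k hx with ⟨rfl, rfl⟩ | ⟨rfl, rfl⟩ | ⟨u1, u2, hx⟩ <;>
    rcases hal y l hy with ⟨rfl, rfl⟩ | ⟨rfl, rfl⟩ | ⟨v1, v2, hy⟩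
    · exact le_rfl
    · exact g1.al_le f1 e11 (by omega) (by omega)
    · exact g2.al_le e21 (o2 _ _ v2 hy) h1 h2
    · exact g2.al_le f2 e21 (by omega) (by omega)
    · exact le_rfl
    · exact g1.al_le e11 (o1 _ _ v1 hy) h1 h2
    · exact g2.al_le (o2 _ _ u2 hx) e21 h1 h2
    · exact g1.al_le (o1 _ _ u1 hx) e11 h1 h2
    · exact g.al_le hx hy h1 h2
  · intro x y k l hx hy h1 h2
    rcases hal x k hx with ⟨rfl, rfl⟩ | ⟨rfl, rfl⟩ | ⟨u1, u2, hx⟩ <;>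
    rcases hal y l hy with ⟨rfl, rfl⟩ | ⟨rfl, rfl⟩ | ⟨v1, v2, hy⟩
    · omega
    · rcases a2 with a2 | a2
      · rcases a1 with a1 | a1
        · exact g.al_lt w2.al w1.al (by omega) (by omega)
        · exact g2.al_lt e21 f2 (by omega) (by omega)
      · exact g1.al_lt f1 e11 (by omega) (by omega)
    · exact g2.al_lt e21 (o2 _ _ v2 hy) h1 h2
    · rcases a1 with a1 | a1
      · rcases a2 with a2 | a2
        · exact g.al_lt w1.al w2.al (by omega) (by omega)
        · exact g1.al_lt e11 f1 (by omega) (by omega)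
      · exact g2.al_lt f2 e21 (by omega) (by omega)
    · omega
    · exact g1.al_lt e11 (o1 _ _ v1 hy) h1 h2
    · exact g2.al_lt (o2 _ _ u2 hx) e21 h1 h2
    · exact g1.al_lt (o1 _ _ u1 hx) e11 h1 h2
    · exact g.al_lt hx hy h1 h2
  · intro x y k l hx hy h1 h2
    rcases hbe x k hx with ⟨rfl, rfl⟩ | ⟨rfl, rfl⟩ | ⟨u1, u2, hx⟩ <;>
    rcases hbe y l hy with ⟨rfl, rfl⟩ | ⟨rfl, rfl⟩ | ⟨v1, v2, hy⟩
    · exact le_rfl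
    · exact g2.be_le e22 q2 (by omega) (by omega)
    · exact g2.be_le e22 (p2 _ _ v2 hy) h1 h2
    · exact g1.be_le e12 q1 (by omega) (by omega)
    · exact le_rfl
    · exact g1.be_le e12 (p1 _ _ v1 hy) h1 h2
    · exact g2.be_le (p2 _ _ u2 hx) e22 h1 h2
    · exact g1.be_le (p1 _ _ u1 hx) e12 h1 h2
    · exact g.be_le hx hy h1 h2
  · intro x y k l hx hy h1 h2
    rcases hbe x k hx with ⟨rfl, rfl⟩ | ⟨rfl, rfl⟩ | ⟨u1, u2, hx⟩ <;>
    rcases hbe y l hy with ⟨rfl, rfl⟩ | ⟨rfl, rfl⟩ | ⟨v1, v2, hy⟩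
    · omega
    · rcases a1 with a1 | a1
      · exact g2.be_lt e22 q2 (by omega) (by omega)
      · rcases a2 with a2 | a2
        · exact g1.be_lt q1 e12 (by omega) (by omega)
        · exact g.be_lt w2.be w1.be (by omega) (by omega)
    · exact g2.be_lt e22 (p2 _ _ v2 hy) h1 h2
    · rcases a2 with a2 | a2
      · exact g1.be_lt e12 q1 (by omega) (by omega)
      · rcases a1 with a1 | a1
        · exact g2.be_lt q2 e22 (by omega) (by omega)
        · exact g.be_lt w1.be w2.be (by omega) (by omega)
    · omega
    · exact g1.be_lt e12 (p1 _ _ v1 hy) h1 h2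
    · exact g2.be_lt (p2 _ _ u2 hx) e22 h1 h2
    · exact g1.be_lt (p1 _ _ u1 hx) e12 h1 h2
    · exact g.be_lt hx hy h1 h2

lemma Move.diamond {T1 T2 : MixedTableau} (h1 : Move S A T T1) (h2 : Move S A T T2) :
    T1 = T2 ∨ ∃ T3, Move S A T1 T3 ∧ Move S A T2 T3 := by
  obtain ⟨g, g1, c1, c1', r1, s1, w1, m1⟩ := h1
  obtain ⟨-, g2, c2, c2', r2, s2, w2, m2⟩ := h2
  have a1 := adj_iff.1 w1.adj
  have a2 := adj_iff.1 w2.adj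
  by_cases hne : c1 = c2
  · subst hne
    by_cases hne' : c1' = c2'
    · subst hne'
      exact Or.inl (w1.eq.trans w2.eq.symm)
    have n := cell_ne hne'
    exfalso
    have q1 := w1.be_iff.2 (Or.inr ⟨Ne.symm hne', w2.be⟩)
    have q2 := w2.be_iff.2 (Or.inr ⟨hne', w1.be⟩)
    have t1 := g1.be_le w1.apply_left q1 (by omega) (by omega)
    have t2 := g2.be_le w2.apply_left q2 (by omega) (by omega)
    rcases a1 with a1 | a1
    · have := g2.be_lt w2.apply_left q2 (by omega) (by omega)
      omega
    · have := g1.be_lt w1.apply_left q1 (by omega) (by omega)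
      omega
  by_cases hne' : c1' = c2'
  · subst hne'
    have n := cell_ne hne
    exfalso
    have q1 := w1.al_iff.2 (Or.inr ⟨Ne.symm hne, w2.al⟩)
    have q2 := w2.al_iff.2 (Or.inr ⟨hne, w1.al⟩)
    have t1 := g1.al_le q1 w1.apply_right (by omega) (by omega)
    have t2 := g2.al_le q2 w2.apply_right (by omega) (by omega)
    rcases a1 with a1 | a1
    · have := g1.al_lt q1 w1.apply_right (by omega) (by omega)
      omega
    · have := g2.al_lt q2 w2.apply_right (by omega) (by omega)
      omega
  have n12 : c1 ≠ c2' := by rintro rfl; exact al_be w1.al w2.be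
  have n21 : c2 ≠ c1' := by rintro rfl; exact al_be w2.al w1.be
  have w3 : Swap T1 (swapCells T1 c2 c2') c2 c2' r2 s2 :=
    ⟨w2.adj, w1.al_iff.2 (Or.inr ⟨Ne.symm hne, w2.al⟩),
      w1.be_iff.2 (Or.inr ⟨Ne.symm hne', w2.be⟩), rfl⟩
  have w4 : Swap T2 (swapCells T1 c2 c2') c1 c1' r1 s1 := by
    refine ⟨w1.adj, w2.al_iff.2 (Or.inr ⟨hne, w1.al⟩), w2.be_iff.2 (Or.inr ⟨hne', w1.be⟩), ?_⟩
    rw [w1.eq, w2.eq]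
    funext x
    have := hne
    have := hne'
    simp only [swapCells, Function.update_apply]
    grind
  have g3 := good_of_commute g g1 g2 w1 w2 w3 hne hne'
  exact Or.inr ⟨_, ⟨g1, g3, _, _, _, _, w3, m2⟩, ⟨g2, g3, _, _, _, _, w4, m1⟩⟩

lemma Move.church_rosser {T1 T2 : MixedTableau} (h1 : Relation.ReflTransGen (Move S A) T T1)
    (h2 : Relation.ReflTransGen (Move S A) T T2) :
    Relation.Join (Relation.ReflTransGen (Move S A)) T1 T2 := by
  refine Relation.church_rosser ?_ h1 h2
  intro a b c hb hc
  rcases hb.diamond hc with rfl | ⟨d, h1, h2⟩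
  · exact ⟨b, .refl, .refl⟩
  · exact ⟨d, .single h1, .single h2⟩

lemma Move.exists_oo (h : Move S A T T') : ∃ c r, OO A T c r := by
  obtain ⟨-, -, c, c', r, s, w, m⟩ := h
  exact ⟨c, r, w.al, c', s, w.adj, w.be, m⟩

lemma Move.eq_of_normal (h : Relation.ReflTransGen (Move S A) T T')
    (hn : ∀ c r, ¬ OO A T c r) : T = T' := by
  rcases h.cases_head with h | ⟨U, h, -⟩
  · exact h
  · obtain ⟨c, r, h⟩ := h.exists_oo
    exact absurd h (hn c r)

lemma Move.unique_normal {T1 T2 : MixedTableau} (h1 : Relation.ReflTransGen (Move S A) T T1)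
    (h2 : Relation.ReflTransGen (Move S A) T T2) (hn1 : ∀ c r, ¬ OO A T1 c r)
    (hn2 : ∀ c r, ¬ OO A T2 c r) : T1 = T2 := by
  obtain ⟨U, k1, k2⟩ := Move.church_rosser h1 h2
  rw [Move.eq_of_normal k1 hn1, Move.eq_of_normal k2 hn2]

lemma Move.mono (hAB : A ⊆ B) (h : Relation.ReflTransGen (Move S A) T T') :
    Relation.ReflTransGen (Move S B) T T' :=
  Relation.ReflTransGen.mono
    (fun _ _ ⟨g, g', c, c', r, s, w, m⟩ => ⟨g, g', c, c', r, s, w, hAB m⟩) _ _ h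

lemma Move.mcount_eq (h : Relation.ReflTransGen (Move S A) T T') (e : MEntry) :
    mcount T' e = mcount T e := by
  induction h with
  | refl => rfl
  | tail _ h ih =>
    obtain ⟨-, -, c, c', r, s, w, -⟩ := h
    rw [w.mcount_eq, ih]

/-- Exchange `α` and `β`. -/
def _root_.MEntry.flip : MEntry → MEntry
  | .al k => .be k
  | .be k => .al k

/-- Transpose a mixed tableau and exchange `α` and `β`. -/
def flip (T : MixedTableau) : MixedTableau := fun c => (T c.swap).map MEntry.flip

lemma flip_al : flip T x = some (.al k) ↔ T x.swap = some (.be k) := by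
  unfold flip
  rcases T x.swap with _ | (l | l) <;> simp [MEntry.flip]

lemma flip_be : flip T x = some (.be k) ↔ T x.swap = some (.al k) := by
  unfold flip
  rcases T x.swap with _ | (l | l) <;> simp [MEntry.flip]

lemma flip_flip (T : MixedTableau) : flip (flip T) = T := by
  funext x
  simp only [flip, Prod.swap_swap]
  rcases T x with _ | (l | l) <;> simp [MEntry.flip]

lemma adj_swap : Adj c.swap c'.swap ↔ Adj c c' := by
  simp only [adj_iff, Prod.fst_swap, Prod.snd_swap]
  tauto

lemma gap_swap (h : Adj c c') : gap c.swap c'.swap r s = 1 - gap c c' s r := by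
  rw [adj_iff] at h
  simp only [gap, Prod.fst_swap, Prod.snd_swap]
  omega

/-- The image of a set of cells under transposition. -/
def tr (S : Set Cell) : Set Cell := Prod.swap ⁻¹' S

lemma tr_tr (S : Set Cell) : tr (tr S) = S := rfl

lemma Conv.tr (h : Conv S) : Conv (tr S) :=
  fun _ _ _ hc hc' h1 h2 h3 h4 => h _ _ _ hc hc' h2 h1 h4 h3

lemma mshape_flip (T : MixedTableau) : mshape (flip T) = tr (mshape T) := by
  ext x
  simp [mshape, flip, tr]

lemma Good.flip (h : Good S T) : Good (tr S) (flip T) := by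
  refine Good.of_lt (by rw [mshape_flip, h.shape]) ?_ ?_ ?_ ?_
  · intro x y k l hx hy h1 h2
    exact h.be_le (flip_al.1 hx) (flip_al.1 hy) h2 h1
  · intro x y k l hx hy h1 h2
    exact h.be_lt (flip_al.1 hx) (flip_al.1 hy) h2 h1
  · intro x y k l hx hy h1 h2
    exact h.al_le (flip_be.1 hx) (flip_be.1 hy) h2 h1
  · intro x y k l hx hy h1 h2
    exact h.al_lt (flip_be.1 hx) (flip_be.1 hy) h2 h1

lemma flip_swapCells (T : MixedTableau) (c c' : Cell) :
    flip (swapCells T c c') = swapCells (flip T) c'.swap c.swap := by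
  funext x
  have h (y : Cell) : x.swap = y ↔ x = y.swap := ⟨fun h => by simp [← h], fun h => by simp [h]⟩
  simp only [flip, swapCells, Function.update_apply, h, Prod.swap_swap]
  grind

lemma Swap.flip (h : Swap T T' c c' r s) :
    Swap (flip T') (flip T) c.swap c'.swap s r := by
  refine ⟨adj_swap.2 h.adj, flip_al.2 ?_, flip_be.2 ?_, ?_⟩
  · simpa using h.apply_left
  · simpa using h.apply_right
  · have := h.ne
    rw [h.eq, flip_swapCells]
    funext x
    simp only [swapCells, Function.update_apply]
    grind

/-- The set of gaps of reversed switches. -/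
def rev (A : Set ℤ) : Set ℤ := (fun d => 1 - d) ⁻¹' A

lemma Move.flip (h : Move S A T T') : Move (tr S) (rev A) (flip T') (flip T) := by
  obtain ⟨g, g', c, c', r, s, w, m⟩ := h
  refine ⟨g'.flip, g.flip, _, _, _, _, w.flip, ?_⟩
  rw [gap_swap w.adj]
  simpa [rev] using m

lemma Move.flips (h : Relation.ReflTransGen (Move S A) T T') :
    Relation.ReflTransGen (Move (tr S) (rev A)) (GGJdt.flip T') (GGJdt.flip T) := by
  induction h with
  | refl => exact .refl
  | tail _ h ih => exact .head h.flip ih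

lemma passed_flip (hN : ∀ c r, ¬ OO A T c r) : Passed (rev A)ᶜ (flip T) := by
  intro c c' r s ha hc hc' hm
  refine hN c.swap s ⟨flip_be.1 hc, c'.swap, r, adj_swap.2 ha, flip_al.1 hc', ?_⟩
  rw [gap_swap ha]
  exact hm

lemma normal_flip (hP : Passed A T) (c : Cell) (r : ℤ) : ¬ OO (rev A)ᶜ (flip T) c r := by
  rintro ⟨hc, c', s, ha, hc', hm⟩
  apply hm
  have := hP c.swap c'.swap s r (adj_swap.2 ha) (flip_al.1 hc) (flip_be.1 hc')
  rwa [gap_swap ha] at this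

/-- `α_r` in the cell `c` is the rightmost among those with gap in `A` and minimal index. -/
def Chosen (A : Set ℤ) (T : MixedTableau) (c : Cell) (r : ℤ) : Prop :=
  OO A T c r ∧ (∀ c' r', OO A T c' r' → r ≤ r') ∧ ∀ c', OO A T c' r → c'.2 ≤ c.2

/-- A slide of the chosen `α_r`, with the tie-breaking rule common to the shuffle and GG-jdt. -/
structure Step (A : Set ℤ) (T T' : MixedTableau) (c c' : Cell) (r s : ℤ) : Prop where
  chosen : Chosen A T c r
  swap : Swap T T' c c' r s
  gap_mem : gap c c' r s ∈ A
  tie : (c' = rtCell c ∧ ∀ t, T (upCell c) = some (.be t) → t ≤ s) ∨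
    (c' = upCell c ∧ ∀ t, T (rtCell c) = some (.be t) → t < s)

/-- Between `x` and `y` there is a staircase of `β`s which no slide of an `α_q` from the left can
enter: `e a` is the column left of the `β` of the staircase in row `a`. -/
def Wall (T : MixedTableau) (q : ℤ) (x y : Cell) : Prop :=
  ∃ e : ℕ → ℕ, (∀ a, x.1 ≤ a → a < y.1 → x.2 ≤ e a ∧ e a < y.2 ∧
      ∃ v, T (a, e a + 1) = some (.be v) ∧ (∀ p, T (a + 1, e a) = some (.al p) → q ≤ p) ∧
        ∀ u, T (a + 1, e a) = some (.be u) → v < u) ∧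
    ∀ a, x.1 ≤ a → a + 1 < y.1 → e a ≤ e (a + 1)

/-- The invariant of the sliding process with gaps in `A`, started from a good filling without
`α`s having gap in `B`. -/
structure Inv (B A : Set ℤ) (S : Set Cell) (T : MixedTableau) : Prop where
  good : Good S T
  normal : ∀ c r, ¬ OO B T c r
  passed : Passed A T
  behind : ∀ z x v q, Adj z x → T z = some (.be v) → T x = some (.al q) → gap z x q v ∉ B →
    ∀ y p, OO A T y p → q ≤ p ∧ (p = q → y.2 ≤ x.2)
  pairs : ∀ q x y, T x = some (.al q) → T y = some (.al q) → x.1 < y.1 → x.2 < y.2 →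
    ∀ c r, OO A T c r → q ≤ r
  wall : ∀ q x y, T x = some (.al q) → T y = some (.al q) → x.1 < y.1 → x.2 < y.2 →
    (∀ z, T z = some (.al q) → x.2 < z.2 → ¬ z.2 < y.2) → Wall T q x y

lemma Inv.init (h : Good S T) (hS : Conv S) (hB : IsUpperSet B)
    (hN : ∀ c r, ¬ OO B T c r) (hP : Passed B T) (hBA : B ⊆ A) : Inv B A S T where
  good := h
  normal := hN
  passed z x r s ha hz hx := hBA (hP z x r s ha hz hx)
  behind z x v q ha hz hx hg := absurd (hP z x q v ha hz hx) hg
  pairs q x y hx hy h1 h2 := by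
    obtain ⟨a, p, ho, -⟩ := h.exists_oo_of_strict_pair hS hB hP hx hy h1 h2
    exact absurd ho (hN a p)
  wall q x y hx hy h1 h2 := by
    obtain ⟨a, p, ho, -⟩ := h.exists_oo_of_strict_pair hS hB hP hx hy h1 h2
    exact absurd ho (hN a p)

/-- A switch of gap outside `B` creates no `α` with gap in `B`. -/
lemma Swap.normal (w : Swap T T' c c' r s) (g : Good S T) (hB : IsUpperSet B)
    (hN : ∀ c r, ¬ OO B T c r) : ∀ c r, ¬ OO B T' c r := by
  have hc : gap c c' r s ∉ B := fun h => hN c r ⟨w.al, c', s, w.adj, w.be, h⟩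
  have hcc := adj_iff.1 w.adj
  rintro a p ⟨ha, b, u, hab, hb, hg⟩
  have hab' := adj_iff.1 hab
  rw [w.al_iff] at ha
  rw [w.be_iff] at hb
  have key (h : gap a b p u ≤ gap c c' r s) : False := hc (hB h hg)
  simp only [gap] at key
  rcases ha with ⟨rfl, rfl⟩ | ⟨hac, ha⟩
  · rcases hb with ⟨rfl, rfl⟩ | ⟨hbc, hb⟩
    · omega
    · have h1 := g.be_le w.be hb (by omega) (by omega)
      rcases hab' with h | h
      · have := g.be_lt w.be hb (by omega) (by omega)
        apply key; omega
      · apply key; omega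
  · rcases hb with ⟨rfl, rfl⟩ | ⟨hbc, hb⟩
    · have h1 := g.al_le ha w.al (by omega) (by omega)
      rcases hab' with h | h
      · apply key; omega
      · have := g.al_lt ha w.al (by omega) (by omega)
        apply key; omega
    · exact hN a p ⟨ha, b, u, hab, hb, hg⟩

/-- A switch of gap in `A` creates no `β` having passed an `α` with gap outside `A`. -/
lemma Swap.passed (w : Swap T T' c c' r s) (g : Good S T) (hA : IsUpperSet A)
    (hg : gap c c' r s ∈ A) (hP : Passed A T) : Passed A T' := by
  have hcc := adj_iff.1 w.adj
  intro z x q v ha hz hx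
  have ha' := adj_iff.1 ha
  rw [w.be_iff] at hz
  rw [w.al_iff] at hx
  have key (h : gap c c' r s ≤ gap z x q v) : gap z x q v ∈ A := hA h hg
  simp only [gap] at key ⊢
  rcases hz with ⟨rfl, rfl⟩ | ⟨hzc, hz⟩
  · rcases hx with ⟨rfl, rfl⟩ | ⟨hxc, hx⟩
    · exact hg
    · have h1 := g.al_le w.al hx (by omega) (by omega)
      rcases ha' with h | h
      · apply key; omega
      · have := g.al_lt w.al hx (by omega) (by omega)
        apply key; omega
  · rcases hx with ⟨rfl, rfl⟩ | ⟨hxc, hx⟩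
    · have h1 := g.be_le hz w.be (by omega) (by omega)
      rcases ha' with h | h
      · have := g.be_lt hz w.be (by omega) (by omega)
        apply key; omega
      · apply key; omega
    · exact hP z x q v ha hz hx

namespace Step

lemma gap_notMem (h : Step A T T' c c' r s) (hN : ∀ c r, ¬ OO B T c r) : gap c c' r s ∉ B :=
  fun hg => hN c r ⟨h.swap.al, c', s, h.swap.adj, h.swap.be, hg⟩

/-- After a step, the moved `α` is still the rightmost of minimal index. -/
lemma oo (h : Step A T T' c c' r s) (g : Good S T) (ho : OO A T' x k) :
    r ≤ k ∧ (k = r → x.2 ≤ c'.2) := by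
  have hcc := adj_iff.1 h.swap.adj
  obtain ⟨ha, b, u, hab, hb, hg⟩ := ho
  have hab' := adj_iff.1 hab
  rw [h.swap.al_iff] at ha
  rw [h.swap.be_iff] at hb
  rcases ha with ⟨rfl, rfl⟩ | ⟨hac, ha⟩
  · exact ⟨le_rfl, fun _ => le_rfl⟩
  · rcases hb with ⟨rfl, rfl⟩ | ⟨hbc, hb⟩
    · exact ⟨g.al_le ha h.swap.al (by omega) (by omega), fun _ => by omega⟩
    · have ho : OO A T x k := ⟨ha, b, u, hab, hb, hg⟩
      refine ⟨h.chosen.2.1 _ _ ho, ?_⟩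
      rintro rfl
      have := h.chosen.2.2 _ ho
      omega

/-- In a vertical step, the `α`s to the left of the target have index at least `r`. -/
lemma le_of_vert (h : Step A T T' c c' r s) (g : Good S T) (hS : Conv S) (hA : IsUpperSet A)
    (hv : c' = upCell c) (hx : T x = some (.al k)) (h1 : x.1 = c'.1) (h2 : x.2 < c'.2) :
    r ≤ k := by
  by_contra! hk
  subst hv
  obtain ⟨a, p, u, f1, f2, f3, f4, f5, f6, f7⟩ :=
    g.rowRun hS (n := (upCell c).2 - x.2) hx h.swap.be h1 (by omega)
  have hp := h.chosen.2.1 a p ⟨f1, rtCell a, u, adj_rtCell a, f2, hA ?_ h.gap_mem⟩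
  · omega
  · simp only [gap, rtCell_snd, upCell_snd, upCell_fst] at *
    omega

/-- In a horizontal step, the `α`s of the target column below the target have larger index. -/
lemma lt_of_horiz (h : Step A T T' c c' r s) (g : Good S T) (hS : Conv S) (hA : IsUpperSet A)
    (hh : c' = rtCell c) (hx : T x = some (.al k)) (h1 : x.1 < c'.1) (h2 : x.2 = c'.2) :
    r < k := by
  by_contra! hk
  subst hh
  obtain ⟨a, p, u, f1, f2, f3, f4, f5, f6, f7⟩ :=
    g.colRun hS (n := (rtCell c).1 - x.1) hx h.swap.be h2 (by omega)
  have ho : OO A T a p := by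
    refine ⟨f1, upCell a, u, adj_upCell a, f2, hA ?_ h.gap_mem⟩
    simp only [gap, rtCell_snd, upCell_snd, rtCell_fst] at *
    omega
  have hp := h.chosen.2.1 a p ho
  obtain rfl : p = r := by omega
  have := h.chosen.2.2 a ho
  rw [rtCell_snd] at h2
  omega

/-- A wall starting at the cell of a horizontally moving entry starts beyond the target. -/
lemma wall_start (h : Step A T T' c c' r s) (g : Good S T) (hS : Conv S) (hh : c' = rtCell c)
    {e : ℕ → ℕ} (hy : T y = some (.al r)) (h1 : c.1 < y.1) (h2 : c.2 < y.2)
    (he : c.2 ≤ e c.1 ∧ e c.1 < y.2 ∧ ∃ v, T (c.1, e c.1 + 1) = some (.be v) ∧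
      (∀ p, T (c.1 + 1, e c.1) = some (.al p) → r ≤ p) ∧
        ∀ u, T (c.1 + 1, e c.1) = some (.be u) → v < u) : c.2 + 1 ≤ e c.1 := by
  obtain ⟨e1, e2, v, e3, e4, e5⟩ := he
  by_contra! hlt
  have h0 : e c.1 = c.2 := by omega
  rw [h0] at e3 e4 e5
  have hb := h.swap.be
  rw [hh] at hb
  obtain rfl : v = s := by
    have : some (MEntry.be v) = some (.be s) := e3.symm.trans hb
    simpa using this
  have hu : upCell c ∈ S := hS c y _ (g.mem h.swap.al) (g.mem hy) (by rw [upCell_fst]; omega)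
    (by rw [upCell_snd]) (by rw [upCell_fst]; omega) (by rw [upCell_snd]; omega)
  rcases g.entry hu with ⟨p, hp⟩ | ⟨u, hu⟩
  · have := e4 p hp
    have := g.al_lt h.swap.al hp (by rw [upCell_fst]; omega) (by rw [upCell_snd])
    omega
  · have := e5 u hu
    rcases h.tie with ⟨-, ht⟩ | ⟨hv, -⟩
    · have := ht u hu
      omega
    · have := congrArg Prod.fst (hh.symm.trans hv)
      rw [rtCell_fst, upCell_fst] at this
      omega

lemma good (h : Step A T T' c c' r s) (I : Inv B A S T) (hS : Conv S) (hA : IsUpperSet A)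
    (hB : IsUpperSet B) : Good S T' := by
  have g := I.good
  have w := h.swap
  have hcc := adj_iff.1 w.adj
  have hgA := h.gap_mem
  have hgB := h.gap_notMem I.normal
  have hmin := h.chosen.2.1
  have hright := h.chosen.2.2
  have tieH (hh : c'.1 = c.1) : c' = rtCell c := by
    rcases h.tie with ⟨h, -⟩ | ⟨h, -⟩
    · exact h
    · rw [h, upCell_fst] at hh
      omega
  have tieV (hh : c'.2 = c.2) : c' = upCell c := by
    rcases h.tie with ⟨h, -⟩ | ⟨h, -⟩
    · rw [h, rtCell_snd] at hh
      omega
    · exact h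
  have tieH' (hh : c'.1 = c.1) : ∀ t, T (upCell c) = some (.be t) → t ≤ s := by
    rcases h.tie with ⟨-, h⟩ | ⟨h, -⟩
    · exact h
    · rw [h, upCell_fst] at hh
      omega
  have tieV' (hh : c'.2 = c.2) : ∀ t, T (rtCell c) = some (.be t) → t < s := by
    rcases h.tie with ⟨h, -⟩ | ⟨-, h⟩
    · rw [h, rtCell_snd] at hh
      omega
    · exact h
  refine Good.of_lt (w.mshape_eq.trans g.shape) ?_ ?_ ?_ ?_
  · intro x y k l hx hy h1 h2
    rw [w.al_iff] at hx hy
    rcases hx with ⟨rfl, rfl⟩ | ⟨hxc, hx⟩ <;> rcases hy with ⟨rfl, rfl⟩ | ⟨hyc, hy⟩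
    · exact le_rfl
    · exact g.al_le w.al hy (by omega) (by omega)
    · have hne : x ≠ y := fun e => al_be hx (e ▸ w.be)
      have hne := cell_ne hne
      rcases hcc with hh | hv
      · by_cases h3 : x.2 = y.2
        · exact (h.lt_of_horiz g hS hA (tieH hh.1) hx (by omega) h3).le
        · exact g.al_le hx w.al (by omega) (by omega)
      · by_cases h3 : x.1 = y.1
        · exact h.le_of_vert g hS hA (tieV hv.2) hx h3 (by omega)
        · exact g.al_le hx w.al (by omega) (by omega)
    · exact g.al_le hx hy h1 h2
  · intro x y k l hx hy h1 h2
    rw [w.al_iff] at hx hy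
    rcases hx with ⟨rfl, rfl⟩ | ⟨hxc, hx⟩ <;> rcases hy with ⟨rfl, rfl⟩ | ⟨hyc, hy⟩
    · omega
    · rcases hcc with hh | hv
      · refine lt_of_le_of_ne (g.al_le w.al hy (by omega) (by omega)) ?_
        rintro rfl
        obtain ⟨e, he, -⟩ := I.wall l c y w.al hy (by omega) (by omega) (by omega)
        have := he c.1 le_rfl (by omega)
        have := h.wall_start g hS (tieH hh.1) hy (by omega) (by omega) this
        omega
      · exact g.al_lt w.al hy (by omega) (by omega)
    · rcases hcc with hh | hv
      · exact h.lt_of_horiz g hS hA (tieH hh.1) hx (by omega) h2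
      · have := cell_ne hxc
        exact g.al_lt hx w.al (by omega) (by omega)
    · exact g.al_lt hx hy h1 h2
  · intro x y k l hx hy h1 h2
    rw [w.be_iff] at hx hy
    rcases hx with ⟨rfl, rfl⟩ | ⟨hxc, hx⟩ <;> rcases hy with ⟨rfl, rfl⟩ | ⟨hyc, hy⟩
    · exact le_rfl
    · have hne := cell_ne hyc
      by_cases h3 : c'.1 ≤ y.1 ∧ c'.2 ≤ y.2
      · exact g.be_le w.be hy h3.1 h3.2
      have hne2 : x ≠ y := by rintro rfl; exact al_be w.al hy
      have hne2 := cell_ne hne2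
      rcases hcc with hh | hv
      · obtain ⟨a, p, u, f1, f2, f3, f4, f5, f6, f7⟩ :=
          g.colRun hS (n := y.1 - x.1) w.al hy (by omega) (by omega)
        by_contra! hlt
        by_cases ha : a.1 = x.1
        · obtain rfl : a = x := Prod.ext ha f3
          have := tieH' hh.1 u f2
          omega
        · have := hmin a p ⟨f1, upCell a, u, adj_upCell a, f2, hA (by
            simp only [gap, upCell_snd] at *
            omega) hgA⟩
          omega
      · obtain ⟨a, p, u, f1, f2, f3, f4, f5, f6, f7⟩ :=
          g.rowRun hS (n := y.2 - x.2) w.al hy (by omega) (by omega)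
        by_contra! hlt
        by_cases ha : a.2 = x.2
        · obtain rfl : a = x := Prod.ext f3 ha
          have := tieV' hv.2 u f2
          omega
        · have ho : OO A T a p := ⟨f1, rtCell a, u, adj_rtCell a, f2, hA (by
            simp only [gap, rtCell_snd] at *
            omega) hgA⟩
          have := hmin a p ho
          obtain rfl : p = r := by omega
          have := hright a ho
          omega
    · exact g.be_le hx w.be (by omega) (by omega)
    · exact g.be_le hx hy h1 h2
  · intro x y k l hx hy h1 h2
    rw [w.be_iff] at hx hy
    rcases hx with ⟨rfl, rfl⟩ | ⟨hxc, hx⟩ <;> rcases hy with ⟨rfl, rfl⟩ | ⟨hyc, hy⟩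
    · omega
    · have hne := cell_ne hyc
      rcases hcc with hh | hv
      · exact g.be_lt w.be hy (by omega) (by omega)
      · obtain ⟨a, p, u, f1, f2, f3, f4, f5, f6, f7⟩ :=
          g.rowRun hS (n := y.2 - x.2) w.al hy (by omega) (by omega)
        by_contra! hlt
        by_cases ha : a.2 = x.2
        · obtain rfl : a = x := Prod.ext f3 ha
          have := tieV' hv.2 u f2
          omega
        · have ho : OO A T a p := ⟨f1, rtCell a, u, adj_rtCell a, f2, hA (by
            simp only [gap, rtCell_snd] at *
            omega) hgA⟩
          have := hmin a p ho
          obtain rfl : p = r := by omega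
          have := hright a ho
          omega
    · rcases hcc with hh | hv
      · exact g.be_lt hx w.be (by omega) (by omega)
      · have hz : (c'.1, x.2) ∈ S := hS x c' _ (g.mem hx) (g.mem w.be)
          (by dsimp only; omega) le_rfl le_rfl (by dsimp only; omega)
        rcases g.entry hz with ⟨q, hq⟩ | ⟨u, hu⟩
        · have hrq := h.le_of_vert g hS hA (tieV hv.2) hq rfl (by dsimp only; omega)
          by_contra! hlt
          have hb : gap x (c'.1, x.2) q k ∉ B := by
            refine fun hb => hgB (hB ?_ hb)
            simp only [gap]
            omega
          have := I.behind x (c'.1, x.2) k q (adj_iff.2 (by dsimp only; omega)) hx hq hb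
            y r h.chosen.1
          dsimp only at this
          have := this.2 (by omega)
          omega
        · have h3 := g.be_le hx hu (by dsimp only; omega) le_rfl
          have h4 := g.be_lt hu w.be rfl (by dsimp only; omega)
          omega
    · exact g.be_lt hx hy h1 h2

lemma pair_eq (h : Step A T T' c c' r s) (I : Inv B A S T) (hS : Conv S) (hA : IsUpperSet A)
    (hx : T' x = some (.al k)) (hy : T' y = some (.al k)) (h1 : x.1 < y.1)
    (h2 : x.2 < y.2) : k = r := by
  rw [h.swap.al_iff] at hx hy
  by_contra hne
  obtain ⟨-, hx⟩ := hx.resolve_left fun h => hne h.2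
  obtain ⟨-, hy⟩ := hy.resolve_left fun h => hne h.2
  have := I.pairs k x y hx hy h1 h2 c r h.chosen.1
  obtain ⟨a, p, ho, hp⟩ := I.good.exists_oo_of_strict_pair hS hA I.passed hx hy h1 h2
  have := h.chosen.2.1 a p ho
  omega

lemma wall (h : Step A T T' c c' r s) (I : Inv B A S T) (hS : Conv S)
    (g' : Good S T') (hx : T' x = some (.al r)) (hy : T' y = some (.al r)) (h1 : x.1 < y.1)
    (h2 : x.2 < y.2) (hcons : ∀ z, T' z = some (.al r) → x.2 < z.2 → ¬ z.2 < y.2) :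
    Wall T' r x y := by
  have g := I.good
  have w := h.swap
  have hcc := adj_iff.1 w.adj
  have hc' := w.apply_right
  have hold : ∀ z, z ≠ c → T z = some (.al r) → T' z = some (.al r) :=
    fun z h1 h2 => w.al_iff.2 (Or.inr ⟨h1, h2⟩)
  have hcol : ∀ {z z'}, T' z = some (.al r) → T' z' = some (.al r) → z.2 = z'.2 → z = z' := by
    intro z z' hz hz' he
    by_contra hne
    rcases lt_or_gt_of_ne (fun h => hne (Prod.ext h he) : z.1 ≠ z'.1) with h3 | h3
    · exact absurd (g'.al_lt hz hz' h3 he) (lt_irrefl _)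
    · exact absurd (g'.al_lt hz' hz h3 he.symm) (lt_irrefl _)
  have same : ∀ a b : ℕ, (a ≠ c.1 ∨ b ≠ c.2) → (a ≠ c'.1 ∨ b ≠ c'.2) → T' (a, b) = T (a, b) := by
    intro a b n1 n2
    exact w.apply_of_ne (fun h => by subst h; simp at n1) (fun h => by subst h; simp at n2)
  by_cases hxc : x = c'
  · subst hxc
    have hyc : y ≠ x := by rintro rfl; omega
    obtain ⟨nyc, hy⟩ := (w.al_iff.1 hy).resolve_left fun h => hyc h.1
    obtain ⟨e, he, hm⟩ := I.wall r c y w.al hy (by omega) (by omega) (by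
      intro z hz h3 h4
      have hzc : z ≠ c := by rintro rfl; omega
      have hz' := hold z hzc hz
      by_cases h5 : x.2 < z.2
      · exact hcons z hz' h5 h4
      · have := hcol hz' hc' (by omega)
        rw [this] at hz
        exact al_be hz w.be)
    rcases hcc with hh | hv
    · have hst : c.2 + 1 ≤ e c.1 := by
        rcases h.tie with ⟨h4, -⟩ | ⟨h4, -⟩
        · exact h.wall_start g hS h4 hy (by omega) (by omega) (he c.1 le_rfl (by omega))
        · rw [h4, upCell_fst] at hh
          omega
      have hge : ∀ a, c.1 ≤ a → a < y.1 → c.2 + 1 ≤ e a := by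
        intro a ha
        induction a, ha using Nat.le_induction with
        | base => exact fun _ => hst
        | succ a ha ih => exact fun h3 => (ih (by omega)).trans (hm a ha h3)
      refine ⟨e, fun a ha hay => ?_, fun a ha => hm a (by omega)⟩
      obtain ⟨e1, e2, v, e3, e4, e5⟩ := he a (by omega) hay
      have := hge a (by omega) hay
      refine ⟨by omega, e2, v, ?_⟩
      rw [same _ _ (by omega) (by omega), same _ _ (by omega) (by omega)]
      exact ⟨e3, e4, e5⟩
    · refine ⟨e, fun a ha hay => ?_, fun a ha => hm a (by omega)⟩
      obtain ⟨e1, e2, v, e3, e4, e5⟩ := he a (by omega) hay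
      refine ⟨by omega, e2, v, ?_⟩
      rw [same _ _ (by omega) (by omega), same _ _ (by omega) (by omega)]
      exact ⟨e3, e4, e5⟩
  have hx' := hx
  have hy' := hy
  obtain ⟨nxc, hx⟩ := (w.al_iff.1 hx).resolve_left fun h => hxc h.1
  have nxc' := cell_ne nxc
  by_cases hyc : y = c'
  · subst hyc
    have hxc2 : x.2 < c.2 := by
      rcases hcc with hh | hv
      · by_contra
        have := g.al_lt hx w.al (by omega) (by omega)
        omega
      · omega
    have hcons' : ∀ z, T z = some (.al r) → x.2 < z.2 → ¬ z.2 < c.2 := by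
      intro z hz h3 h4
      have hzc : z ≠ c := by rintro rfl; omega
      exact hcons z (hold z hzc hz) h3 (by omega)
    rcases hcc with hh | hv
    · obtain ⟨e, he, hm⟩ := I.wall r x c hx w.al (by omega) hxc2 hcons'
      refine ⟨e, fun a ha hay => ?_, fun a ha hay => hm a ha (by omega)⟩
      obtain ⟨e1, e2, v, e3, e4, e5⟩ := he a (by omega) (by omega)
      refine ⟨by omega, by omega, v, ?_⟩
      rw [same _ _ (by omega) (by omega), same _ _ (by omega) (by omega)]
      exact ⟨e3, e4, e5⟩
    · have last : ∃ v, T' (c.1, c.2 - 1 + 1) = some (.be v) ∧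
          (∀ p, T' (c.1 + 1, c.2 - 1) = some (.al p) → r ≤ p) ∧
          ∀ u, T' (c.1 + 1, c.2 - 1) = some (.be u) → v < u := by
        refine ⟨s, ?_, ?_, ?_⟩
        · rw [Nat.sub_add_cancel (by omega)]
          exact w.apply_left
        · intro p hp
          exact g'.al_le hp hc' (by dsimp only; omega) (by dsimp only; omega)
        · intro u hu
          rw [same _ _ (by omega) (by omega)] at hu
          exact g.be_lt hu w.be (by dsimp only; omega) (by dsimp only; omega)
      by_cases h3 : x.1 = c.1
      · refine ⟨fun _ => c.2 - 1, fun a ha hay => ?_, fun a ha hay => le_rfl⟩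
        obtain rfl : a = c.1 := by omega
        dsimp only
        exact ⟨by omega, by omega, last⟩
      · obtain ⟨e, he, hm⟩ := I.wall r x c hx w.al (by omega) hxc2 hcons'
        refine ⟨fun a => if a < c.1 then e a else c.2 - 1, fun a ha hay => ?_,
          fun a ha hay => ?_⟩
        · dsimp only
          by_cases h4 : a < c.1
          · rw [if_pos h4]
            obtain ⟨e1, e2, v, e3, e4, e5⟩ := he a (by omega) (by omega)
            refine ⟨by omega, by omega, v, ?_⟩
            rw [same _ _ (by omega) (by omega), same _ _ (by omega) (by omega)]
            exact ⟨e3, e4, e5⟩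
          · obtain rfl : a = c.1 := by omega
            rw [if_neg h4]
            exact ⟨by omega, by omega, last⟩
        · dsimp only
          have := he a ha (by omega)
          by_cases h5 : a + 1 < c.1
          · rw [if_pos (by omega), if_pos h5]
            exact hm a ha h5
          · rw [if_pos (by omega), if_neg h5]
            omega
  obtain ⟨nyc, hy⟩ := (w.al_iff.1 hy).resolve_left fun h => hyc h.1
  have d1 : c'.2 ≠ x.2 := fun e => hxc (hcol hx' hc' e.symm)
  have d2 : c'.2 ≠ y.2 := fun e => hyc (hcol hy' hc' e.symm)
  have d3 := hcons c' hc'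
  have d4 : c.2 ≠ x.2 := by
    intro e
    rcases lt_or_gt_of_ne (fun h => nxc (Prod.ext h e.symm) : x.1 ≠ c.1) with h3 | h3
    · exact absurd (g.al_lt hx w.al h3 e.symm) (lt_irrefl _)
    · exact absurd (g.al_lt w.al hx h3 e) (lt_irrefl _)
  have d5 : c.2 ≠ y.2 := by
    intro e
    rcases lt_or_gt_of_ne (fun h => nyc (Prod.ext h e.symm) : y.1 ≠ c.1) with h3 | h3
    · exact absurd (g.al_lt hy w.al h3 e.symm) (lt_irrefl _)
    · exact absurd (g.al_lt w.al hy h3 e) (lt_irrefl _)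
  obtain ⟨e, he, hm⟩ := I.wall r x y hx hy h1 h2 (by
    intro z hz h3 h4
    by_cases hzc : z = c
    · subst hzc
      omega
    · exact hcons z (hold z hzc hz) h3 h4)
  refine ⟨e, fun a ha hay => ?_, fun a ha hay => hm a ha (by omega)⟩
  obtain ⟨e1, e2, v, e3, e4, e5⟩ := he a (by omega) (by omega)
  refine ⟨by omega, by omega, v, ?_⟩
  rw [same _ _ (by omega) (by omega), same _ _ (by omega) (by omega)]
  exact ⟨e3, e4, e5⟩

/-- The invariant is preserved by a step. -/
lemma inv (h : Step A T T' c c' r s) (I : Inv B A S T) (hS : Conv S) (hA : IsUpperSet A)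
    (hB : IsUpperSet B) : Inv B A S T' := by
  have g := I.good
  have g' := h.good I hS hA hB
  have w := h.swap
  have hcc := adj_iff.1 w.adj
  refine ⟨g', w.normal g hB I.normal, w.passed g hA h.gap_mem I.passed, ?_, ?_, ?_⟩
  · intro z x v q ha hz hx hg y p ho
    have ha' := adj_iff.1 ha
    obtain ⟨h1, h2⟩ := h.oo g ho
    rw [w.al_iff] at hx
    rw [w.be_iff] at hz
    rcases hx with ⟨rfl, rfl⟩ | ⟨hxc, hx⟩
    · exact ⟨h1, h2⟩
    rcases hz with ⟨rfl, rfl⟩ | ⟨hzc, hz⟩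
    · have h3 := g.al_le w.al hx (by omega) (by omega)
      refine ⟨by omega, ?_⟩
      rintro rfl
      have h4 := h2 (by omega)
      rcases ha' with h5 | h5
      · omega
      · have := g.al_lt w.al hx (by omega) (by omega)
        omega
    · have h3 := I.behind z x v q ha hz hx hg c r h.chosen.1
      refine ⟨by omega, ?_⟩
      rintro rfl
      have h4 := h2 (by omega)
      obtain rfl : r = p := by omega
      have h5 := h3.2 rfl
      have := cell_ne hxc
      by_cases h6 : x.2 = c.2
      · rcases lt_or_gt_of_ne (by omega : x.1 ≠ c.1) with h7 | h7
        · exact absurd (g.al_lt hx w.al h7 h6) (lt_irrefl _)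
        · exact absurd (g.al_lt w.al hx h7 h6.symm) (lt_irrefl _)
      · omega
  · intro q x y hx hy h1 h2 a p ho
    rw [h.pair_eq I hS hA hx hy h1 h2]
    exact (h.oo g ho).1
  · intro q x y hx hy h1 h2 hc
    obtain rfl := h.pair_eq I hS hA hx hy h1 h2
    exact h.wall I hS g' hx hy h1 h2 hc

lemma move (h : Step A T T' c c' r s) (I : Inv B A S T) (hS : Conv S) (hA : IsUpperSet A)
    (hB : IsUpperSet B) : Move S (A \ B) T T' :=
  ⟨I.good, h.good I hS hA hB, c, c', r, s, h.swap, h.gap_mem, h.gap_notMem I.normal⟩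

end Step

lemma OO.exists_slide (h : OO A T c r) (hA : IsUpperSet A) :
    ∃ c' s, Swap T (swapCells T c c') c c' r s ∧ gap c c' r s ∈ A ∧
      ((c' = rtCell c ∧ ∀ t, T (upCell c) = some (.be t) → t ≤ s) ∨
        (c' = upCell c ∧ ∀ t, T (rtCell c) = some (.be t) → t < s)) := by
  obtain ⟨hc, c', s, ha, hs, hg⟩ := h
  have hr := adj_rtCell c
  have hu := adj_upCell c
  rcases ha with rfl | rfl
  · by_cases ht : ∃ t, T (upCell c) = some (.be t) ∧ s < t
    · obtain ⟨t, ht, hlt⟩ := ht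
      refine ⟨_, t, ⟨hu, hc, ht, rfl⟩, hA ?_ hg, Or.inr ⟨rfl, fun u hu => ?_⟩⟩
      · simp only [gap, rtCell_snd, upCell_snd]
        omega
      · obtain rfl : s = u := by simpa using hs.symm.trans hu
        exact hlt
    · push Not at ht
      exact ⟨_, s, ⟨hr, hc, hs, rfl⟩, hg, Or.inl ⟨rfl, ht⟩⟩
  · by_cases ht : ∃ t, T (rtCell c) = some (.be t) ∧ s ≤ t
    · obtain ⟨t, ht, hlt⟩ := ht
      refine ⟨_, t, ⟨hr, hc, ht, rfl⟩, hA ?_ hg, Or.inl ⟨rfl, fun u hu => ?_⟩⟩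
      · simp only [gap, rtCell_snd, upCell_snd]
        omega
      · obtain rfl : s = u := by simpa using hs.symm.trans hu
        exact hlt
    · push Not at ht
      exact ⟨_, s, ⟨hu, hc, hs, rfl⟩, hg, Or.inr ⟨rfl, ht⟩⟩

lemma exists_chosen (hf : S.Finite) (g : Good S T) (h : OO A T c r) :
    ∃ c r, Chosen A T c r := by
  let f : Cell → ℤ := fun c => (T c).elim 0 MEntry.idx
  have hfc : ∀ {c r}, OO A T c r → f c = r := fun h => by simp [f, h.1, MEntry.idx]
  obtain ⟨a, ⟨p, ha⟩, hmin⟩ := Set.exists_min_image {c | ∃ r, OO A T c r} f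
    (hf.subset fun _ ⟨_, h⟩ => g.mem h.1) ⟨c, r, h⟩
  obtain ⟨b, hb, hmax⟩ := Set.exists_max_image {c | OO A T c p} Prod.snd
    (hf.subset fun _ h => g.mem h.1) ⟨a, ha⟩
  refine ⟨b, p, hb, fun c' r' h' => ?_, hmax⟩
  have := hmin c' ⟨r', h'⟩
  rwa [hfc ha, hfc h'] at this

/-- The sum of the coordinates of the cells in `F` filled with `β`s. -/
noncomputable def height (F : Finset Cell) (T : MixedTableau) : ℕ :=
  ∑ c ∈ F, if isBetaCell T c then c.1 + c.2 else 0

lemma Swap.height_lt {F : Finset Cell} (h : Swap T T' c c' r s) (hc : c ∈ F) (hc' : c' ∈ F) :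
    height F T' < height F T := by
  have hcc := adj_iff.1 h.adj
  have hm : c ∈ F.erase c' := Finset.mem_erase.2 ⟨h.ne, hc⟩
  rw [height, height, ← Finset.add_sum_erase F _ hc', ← Finset.add_sum_erase _ _ hm,
    ← Finset.add_sum_erase F _ hc', ← Finset.add_sum_erase _ _ hm]
  have e1 : isBetaCell T' c := ⟨s, h.apply_left⟩
  have e2 : ¬ isBetaCell T' c' := by rintro ⟨k, hk⟩; exact al_be h.apply_right hk
  have e3 : ¬ isBetaCell T c := by rintro ⟨k, hk⟩; exact al_be h.al hk
  have e4 : isBetaCell T c' := ⟨s, h.be⟩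
  have e5 : ∑ x ∈ (F.erase c').erase c, (if isBetaCell T' x then x.1 + x.2 else 0) =
      ∑ x ∈ (F.erase c').erase c, if isBetaCell T x then x.1 + x.2 else 0 := by
    refine Finset.sum_congr rfl fun x hx => ?_
    simp only [Finset.mem_erase] at hx
    have : isBetaCell T' x = isBetaCell T x := by
      simp only [isBetaCell, h.apply_of_ne hx.1 hx.2.1]
    simp only [this]
  rw [if_pos e1, if_neg e2, if_neg e3, if_pos e4, e5]
  omega

/-- One slide of the chosen entry. -/
def GStep (A : Set ℤ) (T T' : MixedTableau) : Prop := ∃ c c' r s, Step A T T' c c' r s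

lemma Inv.run (hf : S.Finite) (hS : Conv S) (hA : IsUpperSet A) (hB : IsUpperSet B) :
    ∀ {T}, Inv B A S T → ∃ E, Relation.ReflTransGen (GStep A) T E ∧ ∀ c r, ¬ OO A E c r := by
  intro T
  induction hn : height hf.toFinset T using Nat.strong_induction_on generalizing T with
  | _ n ih =>
    intro I
    by_cases hN : ∃ c r, OO A T c r
    · obtain ⟨c, r, h⟩ := hN
      obtain ⟨c, r, h⟩ := exists_chosen hf I.good h
      obtain ⟨c', s, hs, hg, ht⟩ := h.1.exists_slide hA
      have st : Step A T _ c c' r s := ⟨h, hs, hg, ht⟩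
      obtain ⟨E, hE, hN⟩ := ih _ (hn ▸ hs.height_lt (hf.mem_toFinset.2 (I.good.mem hs.al))
        (hf.mem_toFinset.2 (I.good.mem hs.be))) rfl (st.inv I hS hA hB)
      exact ⟨E, .head ⟨c, c', r, s, st⟩ hE, hN⟩
    · push Not at hN
      exact ⟨T, .refl, hN⟩

lemma Inv.moves (hS : Conv S) (hA : IsUpperSet A) (hB : IsUpperSet B) (I : Inv B A S T)
    (h : Relation.ReflTransGen (GStep A) T T') :
    Inv B A S T' ∧ Relation.ReflTransGen (Move S (A \ B)) T T' := by
  induction h with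
  | refl => exact ⟨I, .refl⟩
  | tail _ h ih =>
    obtain ⟨c, c', r, s, st⟩ := h
    exact ⟨st.inv ih.1 hS hA hB, ih.2.tail (st.move ih.1 hS hA hB)⟩

lemma outOfOrderH_iff :
    OutOfOrderH T c ↔ ∃ r s, T c = some (.al r) ∧ T (rtCell c) = some (.be s) ∧
      gap c (rtCell c) r s ∈ Set.Ioi (0 : ℤ) := by
  simp only [OutOfOrderH, gap, rtCell_snd, Set.mem_Ioi]
  push_cast
  refine exists₂_congr fun r s => and_congr_right fun _ => and_congr_right fun _ => ?_
  omega

lemma outOfOrderV_iff :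
    OutOfOrderV T c ↔ ∃ r s, T c = some (.al r) ∧ T (upCell c) = some (.be s) ∧
      gap c (upCell c) r s ∈ Set.Ioi (0 : ℤ) := by
  simp only [OutOfOrderV, gap, upCell_snd, Set.mem_Ioi]
  refine exists₂_congr fun r s => and_congr_right fun _ => and_congr_right fun _ => ?_
  omega

lemma outOfOrder_iff : OutOfOrder T c ↔ ∃ r, OO (Set.Ioi 0) T c r := by
  rw [OutOfOrder, outOfOrderH_iff, outOfOrderV_iff]
  constructor
  · rintro (⟨r, s, h1, h2, h3⟩ | ⟨r, s, h1, h2, h3⟩)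
    · exact ⟨r, h1, _, s, adj_rtCell c, h2, h3⟩
    · exact ⟨r, h1, _, s, adj_upCell c, h2, h3⟩
  · rintro ⟨r, h1, c', s, rfl | rfl, h2, h3⟩
    · exact Or.inl ⟨r, s, h1, h2, h3⟩
    · exact Or.inr ⟨r, s, h1, h2, h3⟩

lemma OO.of_exists (h : ∃ k, OO A T c k) (hc : T c = some (.al r)) : OO A T c r := by
  obtain ⟨k, h⟩ := h
  obtain rfl : r = k := by simpa using hc.symm.trans h.1
  exact h

lemma GStep.of_ggStep (h : GGStep T T') : GStep (Set.Ioi 0) T T' := by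
  obtain ⟨c, ⟨r, hc, ho, hmin, hmax⟩, hs⟩ := h
  have hch : Chosen (Set.Ioi 0) T c r :=
    ⟨OO.of_exists (outOfOrder_iff.1 ho) hc, fun c' r' h => hmin c' r' h.1 (outOfOrder_iff.2 ⟨_, h⟩),
      fun c' h => hmax c' h.1 (outOfOrder_iff.2 ⟨_, h⟩)⟩
  have idx : ∀ {k}, T c = some (.al k) → k = r := fun h => by simpa using h.symm.trans hc
  rw [GGSlide, outOfOrderH_iff, outOfOrderV_iff] at hs
  rcases hs with ⟨⟨k, s, h1, h2, h3⟩, h4, rfl⟩ | ⟨⟨k, t, h1, h2, h3⟩, h4, rfl⟩ |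
    ⟨⟨k, s, h1, h2, h3⟩, ⟨k', t, h4, h5, h6⟩, s', t', h7, h8, h9⟩
  · obtain rfl := idx h1
    refine ⟨c, _, k, s, hch, ⟨adj_rtCell c, hc, h2, rfl⟩, h3, Or.inl ⟨rfl, fun t ht => ?_⟩⟩
    by_contra! hlt
    refine h4 ⟨k, t, hc, ht, ?_⟩
    simp only [gap, rtCell_snd, upCell_snd, Set.mem_Ioi] at *
    omega
  · obtain rfl := idx h1
    refine ⟨c, _, k, t, hch, ⟨adj_upCell c, hc, h2, rfl⟩, h3, Or.inr ⟨rfl, fun s hs => ?_⟩⟩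
    by_contra! hlt
    refine h4 ⟨k, s, hc, hs, ?_⟩
    simp only [gap, rtCell_snd, upCell_snd, Set.mem_Ioi] at *
    omega
  · obtain rfl := idx h1
    obtain rfl := idx h4
    obtain rfl : s = s' := by simpa using h2.symm.trans h7
    obtain rfl : t = t' := by simpa using h5.symm.trans h8
    rcases h9 with ⟨hle, rfl⟩ | ⟨hlt, rfl⟩
    · refine ⟨c, _, k', s, hch, ⟨adj_rtCell c, hc, h2, rfl⟩, h3, Or.inl ⟨rfl, fun u hu => ?_⟩⟩
      obtain rfl : t = u := by simpa using h5.symm.trans hu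
      exact hle
    · refine ⟨c, _, k', t, hch, ⟨adj_upCell c, hc, h5, rfl⟩, h6, Or.inr ⟨rfl, fun u hu => ?_⟩⟩
      obtain rfl : s = u := by simpa using h2.symm.trans hu
      exact hlt

lemma GStep.ggStep (h : GStep (Set.Ioi 0) T T') : GGStep T T' := by
  obtain ⟨c, c', r, s, hch, hs, hg, ht⟩ := h
  refine ⟨c, ⟨r, hs.al, outOfOrder_iff.2 ⟨r, hch.1⟩,
    fun c' r' h1 h2 => hch.2.1 c' r' (OO.of_exists (outOfOrder_iff.1 h2) h1),
    fun c' h1 h2 => hch.2.2 c' (OO.of_exists (outOfOrder_iff.1 h2) h1)⟩, ?_⟩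
  rcases ht with ⟨rfl, ht⟩ | ⟨rfl, ht⟩
  · have hH : OutOfOrderH T c := outOfOrderH_iff.2 ⟨r, s, hs.al, hs.be, hg⟩
    by_cases hV : OutOfOrderV T c
    · have hV' := hV
      obtain ⟨k, t, -, h2, -⟩ := hV'
      exact Or.inr (Or.inr ⟨hH, hV, s, t, hs.be, h2, Or.inl ⟨ht t h2, hs.eq⟩⟩)
    · exact Or.inl ⟨hH, hV, hs.eq⟩
  · have hV : OutOfOrderV T c := outOfOrderV_iff.2 ⟨r, s, hs.al, hs.be, hg⟩
    by_cases hH : OutOfOrderH T c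
    · have hH' := hH
      obtain ⟨k, t, -, h2, -⟩ := hH'
      exact Or.inr (Or.inr ⟨hH, hV, t, s, h2, hs.be, Or.inr ⟨ht t h2, hs.eq⟩⟩)
    · exact Or.inr (Or.inl ⟨hV, hH, hs.eq⟩)

lemma ggRel_iff {E : MixedTableau} :
    GGRel T E ↔ Relation.ReflTransGen (GStep (Set.Ioi 0)) T E ∧
      ∀ c r, ¬ OO (Set.Ioi 0) E c r := by
  have : GGStep = GStep (Set.Ioi 0) := by
    funext T T'
    exact propext ⟨GStep.of_ggStep, GStep.ggStep⟩
  rw [GGRel, this]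
  simp only [outOfOrder_iff, not_exists]

lemma shuffPending_iff : ShuffPending T c ↔ ∃ r, OO Set.univ T c r := by
  constructor
  · rintro ⟨⟨r, hr⟩, ⟨s, hs⟩ | ⟨s, hs⟩⟩
    · exact ⟨r, hr, _, s, adj_upCell c, hs, trivial⟩
    · exact ⟨r, hr, _, s, adj_rtCell c, hs, trivial⟩
  · rintro ⟨r, hr, c', s, rfl | rfl, hs, -⟩
    · exact ⟨⟨r, hr⟩, Or.inr ⟨s, hs⟩⟩
    · exact ⟨⟨r, hr⟩, Or.inl ⟨s, hs⟩⟩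

lemma shuffChosen_iff : ShuffChosen T c ↔ ∃ r, Chosen Set.univ T c r := by
  constructor
  · rintro ⟨hp, r, hr, hmin, hmax⟩
    exact ⟨r, OO.of_exists (shuffPending_iff.1 hp) hr,
      fun c' r' h => hmin c' r' (shuffPending_iff.2 ⟨_, h⟩) h.1,
      fun c' h => hmax c' (shuffPending_iff.2 ⟨_, h⟩) h.1⟩
  · rintro ⟨r, ho, hmin, hmax⟩
    exact ⟨shuffPending_iff.2 ⟨r, ho⟩, r, ho.1,
      fun c' r' h1 h2 => hmin c' r' (OO.of_exists (shuffPending_iff.1 h1) h2),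
      fun c' h1 h2 => hmax c' (OO.of_exists (shuffPending_iff.1 h1) h2)⟩

lemma shuffSettled_iff (hc : T c = some (.al r)) : ShuffSettled T c ↔ ¬ OO Set.univ T c r := by
  constructor
  · rintro ⟨h1, h2⟩ ho
    obtain ⟨-, h | h⟩ := shuffPending_iff.2 ⟨r, ho⟩
    · exact h1 h
    · exact h2 h
  · intro ho
    exact ⟨fun ⟨s, hs⟩ => ho ⟨hc, _, s, adj_upCell c, hs, trivial⟩,
      fun ⟨s, hs⟩ => ho ⟨hc, _, s, adj_rtCell c, hs, trivial⟩⟩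

lemma Step.of_shuffMoveTo (h : ShuffMoveTo T c c' T') (hc : T c = some (.al r))
    (hch : OO Set.univ T c r → Chosen Set.univ T c r) :
    ∃ s, Step Set.univ T T' c c' r s := by
  obtain ⟨-, rfl, ⟨⟨s, hs⟩, hn, rfl⟩ | ⟨⟨s, hs⟩, hn, rfl⟩ | ⟨t, s, ht, hs, h⟩⟩ := h
  · exact ⟨s, hch ⟨hc, _, s, adj_rtCell c, hs, trivial⟩, ⟨adj_rtCell c, hc, hs, rfl⟩, trivial,
      Or.inl ⟨rfl, fun t ht => absurd ⟨t, ht⟩ hn⟩⟩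
  · exact ⟨s, hch ⟨hc, _, s, adj_upCell c, hs, trivial⟩, ⟨adj_upCell c, hc, hs, rfl⟩, trivial,
      Or.inr ⟨rfl, fun t ht => absurd ⟨t, ht⟩ hn⟩⟩
  · have hch := hch ⟨hc, _, s, adj_rtCell c, hs, trivial⟩
    rcases h with ⟨hlt, rfl⟩ | ⟨hle, rfl⟩
    · refine ⟨t, hch, ⟨adj_upCell c, hc, ht, rfl⟩, trivial, Or.inr ⟨rfl, fun u hu => ?_⟩⟩
      obtain rfl : s = u := by simpa using hs.symm.trans hu
      exact hlt
    · refine ⟨s, hch, ⟨adj_rtCell c, hc, hs, rfl⟩, trivial, Or.inl ⟨rfl, fun u hu => ?_⟩⟩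
      obtain rfl : t = u := by simpa using ht.symm.trans hu
      exact hle

lemma Step.shuffMoveTo (h : Step Set.univ T T' c c' r s) : ShuffMoveTo T c c' T' := by
  refine ⟨⟨r, h.swap.al⟩, h.swap.eq, ?_⟩
  have hb := h.swap.be
  rcases h.tie with ⟨rfl, ht⟩ | ⟨rfl, ht⟩
  · by_cases hu : isBetaCell T (upCell c)
    · obtain ⟨t, hu⟩ := hu
      exact Or.inr (Or.inr ⟨t, s, hu, hb, Or.inr ⟨ht t hu, rfl⟩⟩)
    · exact Or.inl ⟨⟨s, hb⟩, hu, rfl⟩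
  · by_cases hu : isBetaCell T (rtCell c)
    · obtain ⟨t, hu⟩ := hu
      exact Or.inr (Or.inr ⟨s, t, hb, hu, Or.inl ⟨ht t hu, rfl⟩⟩)
    · exact Or.inr (Or.inl ⟨⟨s, hb⟩, hu, rfl⟩)

/-- If a slid entry can still move, then it is again the chosen one. -/
lemma Step.chosen_next (h : Step A T T' c c' r s) (g : Good S T) (ho : OO A T' c' k) :
    Chosen A T' c' k := by
  obtain rfl : r = k := by simpa using h.swap.apply_right.symm.trans ho.1
  exact ⟨ho, fun x l hx => (h.oo g hx).1, fun x hx => (h.oo g hx).2 rfl⟩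

lemma GStep.of_shuffTrack (hS : Conv S) (h : ShuffTrack T c T') :
    ∀ {r}, Inv ∅ Set.univ S T → T c = some (.al r) →
      (OO Set.univ T c r → Chosen Set.univ T c r) →
      Relation.ReflTransGen (GStep Set.univ) T T' := by
  induction h with
  | done => exact fun _ _ _ => .refl
  | step Q c c' Q' R hm _ ih =>
    intro r I hc hch
    obtain ⟨s, st⟩ := Step.of_shuffMoveTo hm hc hch
    exact .head ⟨_, _, _, _, st⟩ (ih (st.inv I hS isUpperSet_univ isUpperSet_empty)
      st.swap.apply_right (st.chosen_next I.good))

lemma GStep.of_shuffRel (hS : Conv S) (h : ShuffRel T T') :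
    Inv ∅ Set.univ S T → Relation.ReflTransGen (GStep Set.univ) T T' ∧
      ∀ c r, ¬ OO Set.univ T' c r := by
  induction h with
  | done Q hN => exact fun _ => ⟨.refl, fun c r ho => hN c (shuffPending_iff.2 ⟨r, ho⟩)⟩
  | step Q c Q' R hch htr _ ih =>
    intro I
    obtain ⟨r, hch⟩ := shuffChosen_iff.1 hch
    have h1 := GStep.of_shuffTrack hS htr I hch.1.1 fun _ => hch
    obtain ⟨h2, h3⟩ := ih (I.moves hS isUpperSet_univ isUpperSet_empty h1).1
    exact ⟨h1.trans h2, h3⟩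

lemma exists_shuffTrack (hf : S.Finite) (hS : Conv S) :
    ∀ {T c r}, Inv ∅ Set.univ S T → T c = some (.al r) →
      (OO Set.univ T c r → Chosen Set.univ T c r) →
      ∃ T', ShuffTrack T c T' ∧ Inv ∅ Set.univ S T' ∧
        height hf.toFinset T' ≤ height hf.toFinset T ∧
        (OO Set.univ T c r → height hf.toFinset T' < height hf.toFinset T) := by
  intro T
  induction hn : height hf.toFinset T using Nat.strong_induction_on generalizing T with
  | _ n ih =>
    intro c r I hc hch
    by_cases ho : OO Set.univ T c r
    · obtain ⟨c', s, hs, hg, ht⟩ := ho.exists_slide isUpperSet_univ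
      have st : Step Set.univ T _ c c' r s := ⟨hch ho, hs, hg, ht⟩
      have hlt := hs.height_lt (hf.mem_toFinset.2 (I.good.mem hs.al))
        (hf.mem_toFinset.2 (I.good.mem hs.be))
      obtain ⟨T', h1, h2, h3, -⟩ := ih _ (hn ▸ hlt) rfl
        (st.inv I hS isUpperSet_univ isUpperSet_empty) hs.apply_right (st.chosen_next I.good)
      exact ⟨T', .step _ _ _ _ _ st.shuffMoveTo h1, h2, by omega, fun _ => by omega⟩
    · exact ⟨T, .done _ _ ((shuffSettled_iff hc).2 ho), I, hn.le, fun h => absurd h ho⟩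

lemma exists_shuffRel (hf : S.Finite) (hS : Conv S) :
    ∀ {T}, Inv ∅ Set.univ S T → ∃ T', ShuffRel T T' := by
  intro T
  induction hn : height hf.toFinset T using Nat.strong_induction_on generalizing T with
  | _ n ih =>
    intro I
    by_cases hN : ∃ c r, OO Set.univ T c r
    · obtain ⟨c, r, h⟩ := hN
      obtain ⟨c, r, h⟩ := exists_chosen hf I.good h
      obtain ⟨T', h1, h2, -, h4⟩ := exists_shuffTrack hf hS I h.1.1 fun _ => h
      obtain ⟨R, hR⟩ := ih _ (hn ▸ h4 h.1) rfl h2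
      exact ⟨R, .step _ c _ _ (shuffChosen_iff.2 ⟨r, h⟩) h1 hR⟩
    · push Not at hN
      refine ⟨T, .done _ fun c hc => ?_⟩
      obtain ⟨r, h⟩ := shuffPending_iff.1 hc
      exact hN c r h

lemma conv_diff {lam mu : Set Cell} (hl : IsPartitionShape lam) (hm : IsPartitionShape mu) :
    Conv (mu \ lam) := by
  rintro c c' ⟨x1, x2⟩ hc hc' h1 h2 h3 h4
  have hc1 := hm.2.1 c hc.1
  refine ⟨hm.2.2 c'.1 c'.2 _ _ hc'.1 (by omega) h3 (by omega) h4, fun hx => hc.2 ?_⟩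
  exact hl.2.2 x1 x2 _ _ hx hc1.1 h1 hc1.2 h2

lemma passed_of_abSortedShape {lam mu : Set Cell} (h : ABSortedShape T lam mu)
    (hm : IsPartitionShape mu) : Passed ∅ T := by
  obtain ⟨nu, hnu, -, -, ha, hb⟩ := h
  intro z x r s hzx hz hx
  have hx' : x ∈ alphaCells T := ⟨r, hx⟩
  have hz' : z ∈ betaCells T := ⟨s, hz⟩
  rw [ha] at hx'
  rw [hb] at hz'
  have h1 := hm.2.1 z hz'.1
  have := adj_iff.1 hzx
  exact absurd (hnu.2.2 x.1 x.2 z.1 z.2 hx'.1 (by omega) (by omega) (by omega) (by omega)) hz'.2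

lemma Good.isBetaCell_of_le (g : Good S T) (hS : Conv S) (hP : Passed ∅ T) :
    ∀ {n : ℕ} {c c' : Cell}, isBetaCell T c → c' ∈ S → c.1 ≤ c'.1 → c.2 ≤ c'.2 →
      c'.1 + c'.2 = c.1 + c.2 + n → isBetaCell T c' := by
  intro n
  induction n with
  | zero =>
    intro c c' hc _ h1 h2 h3
    obtain rfl : c = c' := Prod.ext (by omega) (by omega)
    exact hc
  | succ n ih =>
    rintro c c' ⟨s, hs⟩ hc' h1 h2 h3
    have step (b : Cell) (hb : Adj c b) (h4 : b.1 ≤ c'.1) (h5 : b.2 ≤ c'.2) :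
        isBetaCell T c' := by
      have hb' := adj_iff.1 hb
      rcases g.entry (hS c c' b (g.mem hs) hc' (by omega) (by omega) h4 h5) with ⟨k, hk⟩ | hk
      · exact (hP _ _ _ _ hb hs hk).elim
      · exact ih hk hc' h4 h5 (by omega)
    by_cases h4 : c.1 < c'.1
    · exact step _ (adj_upCell c) h4 h2
    · exact step _ (adj_rtCell c) h1 (by rw [rtCell_snd]; omega)

lemma Good.abSortedShape {lam mu : Set Cell} (g : Good (mu \ lam) T) (hP : Passed ∅ T)
    (hl : IsPartitionShape lam) (hm : IsPartitionShape mu) (hsub : lam ⊆ mu) :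
    ABSortedShape T lam mu := by
  have hS := conv_diff hl hm
  have ha : alphaCells T ⊆ mu \ lam := fun c ⟨k, hk⟩ => g.mem hk
  have hnu : lam ∪ alphaCells T ⊆ mu := Set.union_subset hsub fun c hc => (ha hc).1
  refine ⟨lam ∪ alphaCells T, ⟨hm.1.subset hnu, fun c hc => hm.2.1 c (hnu hc), ?_⟩,
    Set.subset_union_left, hnu, ?_, ?_⟩
  · intro i j i' j' h h1 h2 h3 h4
    rcases h with h | ⟨k, h⟩
    · exact Or.inl (hl.2.2 i j i' j' h h1 h2 h3 h4)
    · by_cases hc : (i', j') ∈ lam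
      · exact Or.inl hc
      have hmem : (i', j') ∈ mu \ lam := ⟨hm.2.2 i j i' j' (g.mem h).1 h1 h2 h3 h4, hc⟩
      rcases g.entry hmem with hk | hk
      · exact Or.inr hk
      · obtain ⟨s, hs⟩ := g.isBetaCell_of_le hS hP (n := i + j - (i' + j')) hk (g.mem h) h2 h4
          (by dsimp only; omega)
        exact absurd hs (al_be h)
  · ext c
    exact ⟨fun h => ⟨Or.inr h, (ha h).2⟩, fun h => h.1.resolve_left h.2⟩
  · ext c
    constructor
    · rintro ⟨s, hs⟩
      refine ⟨(g.mem hs).1, ?_⟩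
      rintro (h | ⟨k, hk⟩)
      · exact (g.mem hs).2 h
      · exact al_be hk hs
    · rintro ⟨h1, h2⟩
      exact (g.entry ⟨h1, fun h => h2 (Or.inl h)⟩).resolve_left fun h => h2 (Or.inr h)

lemma cBetaPlus_al (h : T c = some (.al k)) : cBetaPlus T c = some (.al k) := by
  simp [cBetaPlus, h]

lemma cBetaPlus_be (h : T c = some (.be k)) :
    cBetaPlus T c = some (.be (k + ((c.2 : ℤ) - (c.1 : ℤ)))) := by
  simp [cBetaPlus, h]

lemma cBetaPlus_cases {e : MEntry} (h : cBetaPlus T c = some e) :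
    (∃ k, T c = some (.al k) ∧ e.idx = k) ∨
      ∃ k, T c = some (.be k) ∧ e.idx = k + ((c.2 : ℤ) - (c.1 : ℤ)) := by
  rcases hT : T c with _ | (k | k)
  · simp [cBetaPlus, hT] at h
  · rw [cBetaPlus_al hT, Option.some_inj] at h
    exact Or.inl ⟨k, rfl, h ▸ rfl⟩
  · rw [cBetaPlus_be hT, Option.some_inj] at h
    exact Or.inr ⟨k, rfl, h ▸ rfl⟩

lemma Good.totallyColumnStrict (g : Good S T) (hN : ∀ c r, ¬ OO (Set.Ioi 0) T c r)
    (hP : Passed (Set.Ioi 0) T) : TotallyColumnStrict (cBetaPlus T) := by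
  have hN' : ∀ c c' r s, Adj c c' → T c = some (.al r) → T c' = some (.be s) →
      gap c c' r s ≤ 0 := by
    intro c c' r s ha hc hc'
    by_contra! h
    exact hN c r ⟨hc, c', s, ha, hc', h⟩
  have hP' : ∀ c c' r s, Adj c c' → T c = some (.be s) → T c' = some (.al r) →
      0 < gap c c' r s := hP
  constructor <;> intro c e e' he he'
  · have ha := adj_upCell c
    rcases cBetaPlus_cases he with ⟨k, hk, h1⟩ | ⟨k, hk, h1⟩ <;>
    rcases cBetaPlus_cases he' with ⟨l, hl, h2⟩ | ⟨l, hl, h2⟩ <;> rw [h1, h2]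
    · exact g.al_lt hk hl (by rw [upCell_fst]; omega) (by rw [upCell_snd])
    · have := hN' _ _ _ _ ha hk hl
      simp only [gap, upCell_fst, upCell_snd] at *
      omega
    · have := hP' _ _ _ _ ha hk hl
      simp only [gap, upCell_snd] at *
      omega
    · have := g.be_le hk hl (by rw [upCell_fst]; omega) (by rw [upCell_snd])
      simp only [upCell_fst, upCell_snd]
      omega
  · have ha := adj_rtCell c
    rcases cBetaPlus_cases he with ⟨k, hk, h1⟩ | ⟨k, hk, h1⟩ <;>
    rcases cBetaPlus_cases he' with ⟨l, hl, h2⟩ | ⟨l, hl, h2⟩ <;> rw [h1, h2]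
    · exact g.al_le hk hl (by rw [rtCell_fst]) (by rw [rtCell_snd]; omega)
    · have := hN' _ _ _ _ ha hk hl
      simp only [gap, rtCell_fst, rtCell_snd] at *
      omega
    · have := hP' _ _ _ _ ha hk hl
      simp only [gap, rtCell_snd] at *
      omega
    · have := g.be_lt hk hl (by rw [rtCell_fst]) (by rw [rtCell_snd]; omega)
      simp only [rtCell_fst, rtCell_snd]
      omega

lemma normal_of_totallyColumnStrict (h : TotallyColumnStrict (cBetaPlus T)) (c : Cell) (r : ℤ) :
    ¬ OO (Set.Ioi 0) T c r := by
  rintro ⟨hc, c', s, rfl | rfl, hs, hg⟩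
  · have := h.2 c _ _ (cBetaPlus_al hc) (cBetaPlus_be hs)
    simp only [MEntry.idx, gap, rtCell_fst, rtCell_snd, Set.mem_Ioi] at *
    omega
  · have := h.1 c _ _ (cBetaPlus_al hc) (cBetaPlus_be hs)
    simp only [MEntry.idx, gap, upCell_fst, upCell_snd, Set.mem_Ioi] at *
    omega

lemma passed_of_totallyColumnStrict (h : TotallyColumnStrict (cBetaPlus T)) :
    Passed (Set.Ioi 0) T := by
  rintro c c' r s (rfl | rfl) hc hc'
  · have := h.2 c _ _ (cBetaPlus_be hc) (cBetaPlus_al hc')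
    simp only [MEntry.idx, gap, rtCell_snd, Set.mem_Ioi] at *
    omega
  · have := h.1 c _ _ (cBetaPlus_be hc) (cBetaPlus_al hc')
    simp only [MEntry.idx, gap, upCell_snd, Set.mem_Ioi] at *
    omega

lemma mshape_cBetaPlus (T : MixedTableau) : mshape (cBetaPlus T) = mshape T := by
  ext c
  rcases h : T c with _ | (k | k) <;> simp [mshape, cBetaPlus, h]

lemma idx_le_of_totallyColumnStrict (h : TotallyColumnStrict T) (hS : Conv (mshape T)) :
    ∀ {n : ℕ} {c c' : Cell} {e e' : MEntry}, T c = some e → T c' = some e' → c.1 ≤ c'.1 →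
      c.2 ≤ c'.2 → c'.1 + c'.2 = c.1 + c.2 + n → e'.idx + c'.1 ≤ e.idx + c.1 := by
  intro n
  induction n with
  | zero =>
    intro c c' e e' hc hc' h1 h2 h3
    obtain rfl : c = c' := Prod.ext (by omega) (by omega)
    obtain rfl : e = e' := by simpa using hc.symm.trans hc'
    exact le_rfl
  | succ n ih =>
    intro c c' e e' hc hc' h1 h2 h3
    have m1 : c ∈ mshape T := by simp [mshape, hc]
    have m2 : c' ∈ mshape T := by simp [mshape, hc']
    by_cases h4 : c.1 < c'.1
    · obtain ⟨f, hf⟩ := Option.ne_none_iff_exists'.1 (hS c c' (upCell c) m1 m2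
        (by rw [upCell_fst]; omega) (by rw [upCell_snd]) h4 h2)
      have h5 := h.1 c e f hc hf
      have h6 := ih hf hc' h4 h2 (by rw [upCell_fst, upCell_snd]; omega)
      rw [upCell_fst] at h6
      push_cast at h6
      omega
    · obtain ⟨f, hf⟩ := Option.ne_none_iff_exists'.1 (hS c c' (rtCell c) m1 m2
        (by rw [rtCell_fst]) (by rw [rtCell_snd]; omega) h1 (by rw [rtCell_snd]; omega))
      have h5 := h.2 c e f hc hf
      have h6 := ih hf hc' h1 (by rw [rtCell_snd]; omega) (by rw [rtCell_fst, rtCell_snd]; omega)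
      rw [rtCell_fst] at h6
      omega

lemma Good.of_totallyColumnStrict (h : TotallyColumnStrict (cBetaPlus T)) (hS : Conv S)
    (hT : mshape T = S) : Good S T := by
  have key : ∀ {x y : Cell} {e e' : MEntry}, cBetaPlus T x = some e → cBetaPlus T y = some e' →
      x.1 ≤ y.1 → x.2 ≤ y.2 → e'.idx + y.1 ≤ e.idx + x.1 := fun {x y} _ _ hx hy h1 h2 =>
    idx_le_of_totallyColumnStrict h (by rwa [mshape_cBetaPlus, hT]) (n := y.1 + y.2 - (x.1 + x.2)) hx hy h1 h2 (by omega)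
  refine Good.of_lt hT ?_ ?_ ?_ ?_ <;> intro x y k l hx hy h1 h2
  · have := key (cBetaPlus_al hx) (cBetaPlus_al hy) h1 h2
    simp only [MEntry.idx] at this
    omega
  · have := key (cBetaPlus_al hx) (cBetaPlus_al hy) h1.le h2.le
    simp only [MEntry.idx] at this
    omega
  · have := key (cBetaPlus_be hx) (cBetaPlus_be hy) h1 h2
    simp only [MEntry.idx] at this
    omega
  · have := key (cBetaPlus_be hx) (cBetaPlus_be hy) h1.le h2.le
    simp only [MEntry.idx] at this
    omega

lemma Move.alpha_flag (h : Relation.ReflTransGen (Move S A) T T')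
    (hT : ∀ c k, T c = some (.al k) → 0 < k ∧ k < (c.2 : ℤ)) :
    ∀ c k, T' c = some (.al k) → 0 < k ∧ k < (c.2 : ℤ) := by
  induction h with
  | refl => exact hT
  | tail _ h ih =>
    obtain ⟨-, -, c, c', r, s, w, -⟩ := h
    have hcc := adj_iff.1 w.adj
    intro x k hx
    rcases w.al_iff.1 hx with ⟨rfl, rfl⟩ | ⟨-, hx⟩
    · have := ih c k w.al
      omega
    · exact ih x k hx

lemma Move.beta_flag (h : Relation.ReflTransGen (Move S A) T T')
    (hT : ∀ c k, T' c = some (.be k) → 0 < k ∧ k < (c.1 : ℤ)) :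
    ∀ c k, T c = some (.be k) → 0 < k ∧ k < (c.1 : ℤ) := by
  induction h with
  | refl => exact hT
  | tail _ h ih =>
    obtain ⟨-, -, c, c', r, s, w, -⟩ := h
    have hcc := adj_iff.1 w.adj
    refine ih fun x k hx => ?_
    by_cases hxc : x = c'
    · subst hxc
      obtain rfl : k = s := by simpa using hx.symm.trans w.be
      have := hT c k w.apply_left
      omega
    · exact hT x k (w.be_iff.2 (Or.inr ⟨hxc, hx⟩))

lemma Move.isFMT_back (h : Relation.ReflTransGen (Move S (Set.Ioi 0)) T T') (hT : IsFMT T') :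
    IsFMT T := by
  induction h with
  | refl => exact hT
  | tail _ h ih =>
    refine ih ⟨?_, Move.beta_flag (.single h) hT.2⟩
    obtain ⟨-, -, c, c', r, s, w, hg⟩ := h
    have hcc := adj_iff.1 w.adj
    intro x k hx
    by_cases hxc : x = c
    · subst hxc
      obtain rfl : k = r := by simpa using hx.symm.trans w.al
      have h1 := hT.1 c' k w.apply_right
      have h2 := hT.2 x s w.apply_left
      simp only [gap, Set.mem_Ioi] at hg
      omega
    · exact hT.1 x k (w.al_iff.2 (Or.inr ⟨hxc, hx⟩))

lemma Move.isFMT (h : Relation.ReflTransGen (Move S (Set.univ \ Set.Ioi 0)) T T')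
    (hT : IsFMT T) : IsFMT T' := by
  induction h with
  | refl => exact hT
  | tail _ h ih =>
    refine ⟨Move.alpha_flag (.single h) ih.1, ?_⟩
    obtain ⟨-, -, c, c', r, s, w, hg⟩ := h
    have hcc := adj_iff.1 w.adj
    intro x k hx
    rcases w.be_iff.1 hx with ⟨rfl, rfl⟩ | ⟨-, hx⟩
    · have h1 := ih.2 c' k w.be
      have h2 := ih.1 x r w.al
      simp only [gap, Set.mem_sdiff, Set.mem_univ, Set.mem_Ioi, true_and] at hg
      omega
    · exact ih.2 x k hx

lemma isMixedTableau {lam mu : Set Cell} (h : HasSkewShape T lam mu) (hT : IsFMT T) :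
    IsMixedTableau T := by
  obtain ⟨-, hm, -, hs⟩ := h
  refine ⟨?_, ?_, fun c k hk => (hT.1 c k hk).1⟩ <;> rw [hs]
  · exact hm.1.subset Set.sdiff_subset
  · exact fun c hc => hm.2.1 c hc.1

/-- GG-jdt consists of switches of positive gap, and its result satisfies the local conditions
characterizing exquisite tableaux. -/
lemma ggRel_moves {Q E : MixedTableau} (h : GGRel Q E) (hS : Conv S) (g : Good S Q)
    (hP : Passed ∅ Q) :
    Relation.ReflTransGen (Move S (Set.Ioi 0)) Q E ∧ Good S E ∧
      (∀ c r, ¬ OO (Set.Ioi 0) E c r) ∧ Passed (Set.Ioi 0) E := by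
  obtain ⟨h1, h2⟩ := ggRel_iff.1 h
  have I : Inv ∅ (Set.Ioi 0) S Q := .init g hS isUpperSet_empty (by simp [OO]) hP
    (Set.empty_subset _)
  obtain ⟨I', hm⟩ := I.moves hS (isUpperSet_Ioi 0) isUpperSet_empty h1
  rw [Set.sdiff_empty] at hm
  exact ⟨hm, I'.good, h2, I'.passed⟩

/-- The shuffle factors through GG-jdt, followed by switches of nonpositive gap. -/
lemma shuffRel_moves {Q E R : MixedTableau} (hR : ShuffRel Q R) (hE : GGRel Q E) (hf : S.Finite)
    (hS : Conv S) (g : Good S Q) (hP : Passed ∅ Q) :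
    Relation.ReflTransGen (Move S (Set.univ \ Set.Ioi 0)) E R := by
  have I : Inv ∅ Set.univ S Q := .init g hS isUpperSet_empty (by simp [OO]) hP
    (Set.empty_subset _)
  obtain ⟨h1, h2⟩ := GStep.of_shuffRel hS hR I
  have h3 := (I.moves hS isUpperSet_univ isUpperSet_empty h1).2
  obtain ⟨h4, gE, hN, hPE⟩ := ggRel_moves hE hS g hP
  have J : Inv (Set.Ioi 0) Set.univ S E := .init gE hS (isUpperSet_Ioi 0) hN hPE
    (Set.subset_univ _)
  obtain ⟨R', h5, h6⟩ := J.run hf hS isUpperSet_univ (isUpperSet_Ioi 0)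
  have h7 := (J.moves hS isUpperSet_univ (isUpperSet_Ioi 0) h5).2
  obtain rfl : R' = R := Move.unique_normal (A := Set.univ)
    ((Move.mono (Set.subset_univ _) h4).trans (Move.mono (Set.subset_univ _) h7))
    (Move.mono (Set.subset_univ _) h3) h6 h2
  exact h7

lemma exists_ggRel {Q : MixedTableau} (hf : S.Finite) (hS : Conv S) (g : Good S Q)
    (hP : Passed ∅ Q) : ∃ E, GGRel Q E := by
  have I : Inv ∅ (Set.Ioi 0) S Q := .init g hS isUpperSet_empty (by simp [OO]) hP
    (Set.empty_subset _)
  obtain ⟨E, h1, h2⟩ := I.run hf hS (isUpperSet_Ioi 0) isUpperSet_empty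
  exact ⟨E, ggRel_iff.2 ⟨h1, h2⟩⟩

/-- A sorted filling is determined by any filling obtained from it by switches. -/
lemma Move.unique_sorted {Q Q' E : MixedTableau} (h : Relation.ReflTransGen (Move S A) Q E)
    (h' : Relation.ReflTransGen (Move S A) Q' E) (hP : Passed ∅ Q) (hP' : Passed ∅ Q') :
    Q = Q' := by
  have key : ∀ {Q}, Passed ∅ Q → ∀ c r, ¬ OO Set.univ (GGJdt.flip Q) c r := by
    intro Q hP c r
    have := normal_flip hP c r
    simpa [rev] using this
  have := Move.unique_normal (Move.mono (Set.subset_univ _) (Move.flips h))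
    (Move.mono (Set.subset_univ _) (Move.flips h')) (key hP) (key hP')
  rw [← flip_flip Q, this, flip_flip]

lemma rev_Ioi : (rev (Set.Ioi 0))ᶜ = Set.Ioi 0 := by
  ext d
  simp only [rev, Set.mem_compl_iff, Set.mem_preimage, Set.mem_Ioi]
  omega

lemma rev_diff_Ioi : rev (Set.univ \ Set.Ioi 0) = Set.Ioi 0 := by
  ext d
  simp only [rev, Set.mem_preimage, Set.mem_sdiff, Set.mem_univ, Set.mem_Ioi, true_and]
  omega

/-- Undoing switches of positive gap, every filling satisfying the local conditions of exquisite
tableaux is reached from a sorted one. -/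
lemma Good.exists_sorted {E : MixedTableau} (g : Good S E) (hf : S.Finite) (hS : Conv S)
    (hN : ∀ c r, ¬ OO (Set.Ioi 0) E c r) (hP : Passed (Set.Ioi 0) E) :
    ∃ Q, Good S Q ∧ Passed ∅ Q ∧ Relation.ReflTransGen (Move S (Set.Ioi 0)) Q E := by
  have hN' := normal_flip hP
  have hP' := passed_flip hN
  rw [rev_Ioi] at hN' hP'
  have I : Inv (Set.Ioi 0) Set.univ (tr S) (GGJdt.flip E) :=
    .init g.flip hS.tr (isUpperSet_Ioi 0) hN' hP' (Set.subset_univ _)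
  obtain ⟨R, h1, h2⟩ := I.run (hf.preimage Prod.swap_injective.injOn) hS.tr isUpperSet_univ
    (isUpperSet_Ioi 0)
  obtain ⟨J, h3⟩ := I.moves hS.tr isUpperSet_univ (isUpperSet_Ioi 0) h1
  have h4 := Move.flips h3
  rw [rev_diff_Ioi, flip_flip, tr_tr] at h4
  exact ⟨GGJdt.flip R, J.good.flip, by simpa [rev] using passed_flip h2, h4⟩

end GGJdt

/-- Theorem 4.22 (first map): `jdt_GG : BFT(mu/lam) → EXQ(mu/lam)` is a
weight-preserving bijection. -/
theorem ggjdt_BFT_EXQ_bijection (lam mu : Set Cell)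
    (hl : IsPartitionShape lam) (hm : IsPartitionShape mu) (hsub : lam ⊆ mu) :
    (∀ Q : MixedTableau, IsBFT lam mu Q →
      (∃ E, GGRel Q E) ∧ (∀ E E', GGRel Q E → GGRel Q E' → E = E') ∧
      (∀ E, GGRel Q E → IsEXQ lam mu E ∧ ∀ e : MEntry, mcount Q e = mcount E e)) ∧
    (∀ Q Q' E : MixedTableau, IsBFT lam mu Q → IsBFT lam mu Q' →
      GGRel Q E → GGRel Q' E → Q = Q') ∧
    (∀ E : MixedTableau, IsEXQ lam mu E → ∃ Q, IsBFT lam mu Q ∧ GGRel Q E) := by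
  have hS : GGJdt.Conv (mu \ lam) := GGJdt.conv_diff hl hm
  have hf : (mu \ lam).Finite := hm.1.subset Set.sdiff_subset
  have hQ : ∀ {Q}, IsBFT lam mu Q → GGJdt.Good (mu \ lam) Q ∧ GGJdt.Passed ∅ Q :=
    fun ⟨_, hs, ha, hb, hab, _⟩ => ⟨⟨hs.2.2.2, ha, hb⟩, GGJdt.passed_of_abSortedShape hab hm⟩
  refine ⟨fun Q h => ?_, fun Q Q' E h h' hE hE' => ?_, fun E h => ?_⟩
  · obtain ⟨g, hP⟩ := hQ h
    refine ⟨GGJdt.exists_ggRel hf hS g hP, fun E E' hE hE' => ?_, fun E hE => ?_⟩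
    · obtain ⟨m, -, n, -⟩ := GGJdt.ggRel_moves hE hS g hP
      obtain ⟨m', -, n', -⟩ := GGJdt.ggRel_moves hE' hS g hP
      exact GGJdt.Move.unique_normal m m' n n'
    · obtain ⟨m, gE, n, p⟩ := GGJdt.ggRel_moves hE hS g hP
      obtain ⟨-, -, -, -, -, hF, ⟨R, hR⟩, hFR⟩ := h
      have hs : HasSkewShape E lam mu := ⟨hl, hm, hsub, gE.shape⟩
      have hFE : IsFMT E := ⟨GGJdt.Move.alpha_flag m hF.1,
        GGJdt.Move.beta_flag (GGJdt.shuffRel_moves hR hE hf hS g hP) (hFR R hR).2⟩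
      exact ⟨⟨GGJdt.isMixedTableau hs hFE, hs, hFE, gE.totallyColumnStrict n p⟩,
        fun e => (GGJdt.Move.mcount_eq m e).symm⟩
  · obtain ⟨g, hP⟩ := hQ h
    obtain ⟨g', hP'⟩ := hQ h'
    exact GGJdt.Move.unique_sorted (GGJdt.ggRel_moves hE hS g hP).1
      (GGJdt.ggRel_moves hE' hS g' hP').1 hP hP'
  · obtain ⟨-, hs, hF, hT⟩ := h
    have n := GGJdt.normal_of_totallyColumnStrict hT
    obtain ⟨Q, g, hP, m⟩ := (GGJdt.Good.of_totallyColumnStrict hT hS hs.2.2.2).exists_sorted hf hS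
      n (GGJdt.passed_of_totallyColumnStrict hT)
    obtain ⟨E', hE'⟩ := GGJdt.exists_ggRel hf hS g hP
    obtain ⟨m', -, n', -⟩ := GGJdt.ggRel_moves hE' hS g hP
    obtain rfl : E' = E := GGJdt.Move.unique_normal m' m n' n
    have hsQ : HasSkewShape Q lam mu := ⟨hl, hm, hsub, g.shape⟩
    have hFQ := GGJdt.Move.isFMT_back m hF
    exact ⟨Q, ⟨GGJdt.isMixedTableau hsQ hFQ, hsQ, g.alphaCS, g.betaRS,
      g.abSortedShape hP hl hm hsub, hFQ,
      GGJdt.exists_shuffRel hf hS (.init g hS isUpperSet_empty (by simp [GGJdt.OO]) hP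
        (Set.empty_subset _)),
      fun R hR => GGJdt.Move.isFMT (GGJdt.shuffRel_moves hR hE' hf hS g hP) hF⟩, hE'⟩
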